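/- arXiv:2311.12545 — 2 statements merged into one kernel-verified Lean document; each statement's English description precedes it below -/
import Mathlib

section
/- Let Ω ⊆ ℝ^{p+q+1} be a p-symmetric slice domain, let f ∈ 𝒢𝒮ℳ(Ω), and write f(𝐱) = F₁(𝐱') + ωF₂(𝐱') via the Representation Formula. Then for odd q, τ_q f(𝐱) := (1/(q−1)!!) Δ_𝐱^{(q−1)/2} f(𝐱) = A(𝐱') + ω B(𝐱') is monogenic on Ω, where A = ((1/r)∂_r)^{(q−1)/2} F₁ and B = (∂_r(1/r))^{(q−1)/2} F₂ (values at r = 0 taken as limits). -/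
/-!
Common framework for generalized partial-slice monogenic functions
(Xu–Sabadini, "On the Fueter-Sce theorem for generalized partial-slice
monogenic functions").

The real Clifford algebra `ℝ_{p+q}` is formalized as the Mathlib Clifford
algebra of the negative-definite quadratic form on `ℝ^{p+q}`; since Mathlib
provides no canonical norm on it, all analytic statements are phrased for an
arbitrary normed real algebra `A` together with an `ℝ`-algebra isomorphism
`ξ : A ≃ₐ[ℝ] Cl (p+q)`.  A point of `ℝ^{p+q+1}` is a pair
`(𝐱_p, 𝐱_q) : (Fin (p+1) → ℝ) × EuclideanSpace ℝ (Fin q)`, and a point of a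
slice `ℝ^{p+2}` is a pair `(𝐱_p, r)`.
-/

noncomputable section

open Filter Topology MeasureTheory Metric
open scoped Nat RealInnerProductSpace

namespace GPS

/-- The negative definite quadratic form `-(x₁² + ⋯ + xₙ²)` on `ℝⁿ`. -/
def Qe (n : ℕ) : QuadraticForm ℝ (Fin n → ℝ) :=
  QuadraticMap.weightedSumSquares ℝ (fun _ : Fin n => (-1 : ℝ))

/-- The real Clifford algebra `ℝ_n`. -/
abbrev Cl (n : ℕ) : Type := CliffordAlgebra (Qe n)

/-- The generators `e_1, …, e_n` of `ℝ_n` (indexed by `Fin n`). -/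
def e (n : ℕ) (i : Fin n) : Cl n := CliffordAlgebra.ι (Qe n) (Pi.single i 1)

variable (p q : ℕ)

/-- `ℝ^{p+1}`, the "slice-axis" space. -/
abbrev Vp : Type := Fin (p + 1) → ℝ

/-- `ℝ^q`. -/
abbrev Vq : Type := EuclideanSpace ℝ (Fin q)

/-- `ℝ^{p+q+1} = ℝ^{p+1} ⊕ ℝ^q`. -/
abbrev V : Type := Vp p × Vq q

/-- `ℝ^{p+2}`, the parameter space `(𝐱_p, r)` of a slice. -/
abbrev Sl : Type := Vp p × ℝ

/-- The sphere `𝕊` of unit 1-vectors, described by their coordinate vectors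
`(x_{p+1}, …, x_{p+q}) ∈ ℝ^q` with `∑ x_i² = 1`. -/
def S : Set (Vq q) := {v | ∑ j, v j ^ 2 = 1}

/-- The point `𝐱_p + r ω` of `ℝ^{p+q+1}`. -/
def spt (v : Vq q) (z : Sl p) : V p q := (z.1, z.2 • v)

/-- The (parameterized) slice `Ω_ω` of a set `Ω ⊆ ℝ^{p+q+1}`. -/
def sliceSet (Ω : Set (V p q)) (v : Vq q) : Set (Sl p) := {z | spt p q v z ∈ Ω}

/-- `Ω₀* = {𝐱_p + 𝐱_q : 𝐱_p ∈ Ω₀, 𝐱_q ∈ ℝ^q}`. -/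
def star0 (Ω₀ : Set (Vp p)) : Set (V p q) := {z | z.1 ∈ Ω₀}

/-- The p-symmetric completion `Ω_D` of a set `D ⊆ ℝ^{p+2}`. -/
def completion (D : Set (Sl p)) : Set (V p q) :=
  {x | ∃ z ∈ D, ∃ v ∈ S q, x = spt p q v z}

/-- `D` is invariant under the reflection of the `(p+2)`-th variable. -/
def ReflInv (D : Set (Sl p)) : Prop := ∀ z ∈ D, ((z.1, -z.2) : Sl p) ∈ D

/-- A domain: a nonempty open connected set. -/
def IsDomain {E : Type*} [TopologicalSpace E] (s : Set E) : Prop :=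
  IsOpen s ∧ IsConnected s

/-- A slice domain. -/
def IsSliceDomain (Ω : Set (V p q)) : Prop :=
  IsDomain Ω ∧ (∃ x : Vp p, ((x, 0) : V p q) ∈ Ω) ∧
    ∀ v ∈ S q, IsDomain (sliceSet p q Ω v)

/-- Partial symmetry with respect to `ℝ^{p+1}`. -/
def IsPSymmetric (Ω : Set (V p q)) : Prop :=
  ∀ (x : Vp p) (r : ℝ), ∀ v ∈ S q, ∀ w ∈ S q,
    ((x, r • v) : V p q) ∈ Ω → ((x, r • w) : V p q) ∈ Ω

/-- A `d`-dimensional smooth submanifold of a real normed space. -/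
def IsSmoothSubmanifoldDim {E : Type*} [NormedAddCommGroup E] [NormedSpace ℝ E]
    (d : ℕ) (M : Set E) : Prop :=
  ∀ x ∈ M, ∃ U : Set E, IsOpen U ∧ x ∈ U ∧
    ∃ (ψ : (Fin d → ℝ) → E) (W : Set (Fin d → ℝ)), IsOpen W ∧
      ContDiffOn ℝ (⊤ : ℕ∞) ψ W ∧ Set.InjOn ψ W ∧
      (∀ y ∈ W, Function.Injective (fderivWithin ℝ ψ W y)) ∧
      M ∩ U = ψ '' W

variable {A : Type*} [NormedRing A] [NormedAlgebra ℝ A] (ξ : A ≃ₐ[ℝ] Cl (p + q))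

/-- The generators `e_1, …, e_{p+q}` inside `A`. -/
def gen (i : Fin (p + q)) : A := ξ.symm (e (p + q) i)

/-- The generators `e_{p+1}, …, e_{p+q}` (the "q-part"). -/
def eQ (j : Fin q) : A := gen p q ξ ⟨p + (j : ℕ), by have := j.isLt; omega⟩

/-- The generators `e_1, …, e_p` (the "p-part", without `e_0 = 1`). -/
def eP (i : Fin p) : A := gen p q ξ ⟨(i : ℕ), by have := i.isLt; omega⟩

/-- `e_0 = 1, e_1, …, e_p`: the paravector basis of `ℝ^{p+1}` inside `A`. -/
def εp (i : Fin (p + 1)) : A :=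
  if h : (i : ℕ) = 0 then 1 else gen p q ξ ⟨(i : ℕ) - 1, by have := i.isLt; omega⟩

/-- The 1-vector `∑ x_i e_{p+i} ∈ A` corresponding to `𝐱_q ∈ ℝ^q`;
for a unit `v` this is the imaginary unit `ω ∈ 𝕊`. -/
def ωCl (v : Vq q) : A := ∑ j, v j • eQ p q ξ j

/-- The paravector `x_0 + x_1 e_1 + ⋯ + x_p e_p ∈ A` of `𝐱_p ∈ ℝ^{p+1}`. -/
def clP (x : Vp p) : A := ∑ i, x i • εp p q ξ i

/-- The paravector of `𝐱 ∈ ℝ^{p+q+1}` in `A`. -/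
def toCl (z : V p q) : A := clP p q ξ z.1 + ωCl p q ξ z.2

section SliceOperators

variable {F' : Type*} [NormedAddCommGroup F'] [NormedSpace ℝ F']

/-- `∂_{x_i}` on functions on `ℝ^{p+2}`. -/
def pdSl (i : Fin (p + 1)) (F : Sl p → F') : Sl p → F' :=
  fun z => fderiv ℝ F z (Pi.single i 1, 0)

/-- `∂_r` on functions on `ℝ^{p+2}`. -/
def pdr (F : Sl p → F') : Sl p → F' := fun z => fderiv ℝ F z (0, 1)

/-- `∂_{x_i}` (first factor) on functions on `ℝ^{p+q+1}`. -/
def pdV1 (i : Fin (p + 1)) (f : V p q → F') : V p q → F' :=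
  fun z => fderiv ℝ f z ((Pi.single i 1 : Vp p), 0)

/-- `∂_{x_{p+j}}` (second factor) on functions on `ℝ^{p+q+1}`. -/
def pdV2 (j : Fin q) (f : V p q → F') : V p q → F' :=
  fun z => fderiv ℝ f z (0, EuclideanSpace.single j 1)

/-- `∂_{x_i}` on functions on `ℝ^{p+1}`. -/
def pdP (i : Fin (p + 1)) (g : Vp p → F') : Vp p → F' :=
  fun x => fderiv ℝ g x (Pi.single i 1)

/-- The Laplacian `Δ_{𝐱'} = Δ_{𝐱_p} + ∂_r²` on `ℝ^{p+2}`. -/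
def LapSl (F : Sl p → F') : Sl p → F' :=
  fun z => ∑ i, pdSl p (i := i) (pdSl p i F) z + pdr p (pdr p F) z

/-- The Laplacian `Δ_𝐱` on `ℝ^{p+q+1}`. -/
def LapV (f : V p q → F') : V p q → F' :=
  fun z => ∑ i, pdV1 p q i (pdV1 p q i f) z + ∑ j, pdV2 p q j (pdV2 p q j f) z

/-- The Laplacian `Δ_{𝐱_p}` on `ℝ^{p+1}`. -/
def LapP (g : Vp p → F') : Vp p → F' :=
  fun x => ∑ i, pdP p i (pdP p i g) x

end SliceOperators

/-- The generalized Cauchy–Riemann operator `D_{𝐱_p} = ∑_{i=0}^p e_i ∂_{x_i}`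
on slice functions. -/
def DP (F : Sl p → A) : Sl p → A :=
  fun z => ∑ i, εp p q ξ i * pdSl p i F z

/-- The conjugated operator `D̄_{𝐱_p} = ∂_{x_0} - ∑_{i=1}^p e_i ∂_{x_i}`. -/
def DPbar (F : Sl p → A) : Sl p → A :=
  fun z => pdSl p 0 F z - ∑ i : Fin p, eP p q ξ i * pdSl p i.succ F z

/-- The generalized Cauchy–Riemann (Dirac) operator `D_𝐱` on `ℝ^{p+q+1}`. -/
def DV (f : V p q → A) : V p q → A :=
  fun z => ∑ i, εp p q ξ i * pdV1 p q i f z + ∑ j, eQ p q ξ j * pdV2 p q j f z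

/-- `D_{𝐱_p} = ∑_{i=0}^p e_i ∂_{x_i}` on functions on `ℝ^{p+1}`. -/
def DPfun (g : Vp p → A) : Vp p → A :=
  fun x => ∑ i, εp p q ξ i * pdP p i g x

/-- The slice operator `D_ω = D_{𝐱_p} + ω ∂_r`, expressed on `ℝ^{p+q+1} ∖ ℝ^{p+1}`
(at `𝐱_q = 0` the radial part is junk `0`). -/
def Dslice (f : V p q → A) : V p q → A :=
  fun z => ∑ i, εp p q ξ i * pdV1 p q i f z
    + ωCl p q ξ (‖z.2‖⁻¹ • z.2) * fderiv ℝ f z (0, ‖z.2‖⁻¹ • z.2)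

/-- The spherical Dirac operator `Γ = -∑_{i<j} e_i e_j L_{ij}` on the `ℝ^q` variables. -/
def sphericalDirac (f : V p q → A) : V p q → A :=
  fun z => - ∑ i : Fin q, ∑ j : Fin q,
    if (i : ℕ) < (j : ℕ) then
      eQ p q ξ i * eQ p q ξ j *
        (z.2 i • pdV2 p q j f z - z.2 j • pdV2 p q i f z)
    else 0

/-- `f` is left generalized partial-slice monogenic of type `(p,q)` on `Ω`. -/
def GSMOn (Ω : Set (V p q)) (f : V p q → A) : Prop :=
  ∀ v ∈ S q,
    ContDiffOn ℝ 1 (fun z => f (spt p q v z)) (sliceSet p q Ω v) ∧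
    ∀ z ∈ sliceSet p q Ω v,
      DP p q ξ (fun w => f (spt p q v w)) z
        + ωCl p q ξ v * pdr p (fun w => f (spt p q v w)) z = 0

/-- `f` is (left) monogenic on `Ω`. -/
def MonogenicOn (Ω : Set (V p q)) (f : V p q → A) : Prop :=
  ContDiffOn ℝ 1 f Ω ∧ ∀ z ∈ Ω, DV p q ξ f z = 0

/-- `f` is the generalized partial-slice function on `Ω_D` with components `F1, F2`
(an even–odd pair in the last variable). -/
def IsGPSlice (D : Set (Sl p)) (f : V p q → A) (F1 F2 : Sl p → A) : Prop :=
  (∀ z ∈ D, F1 (z.1, -z.2) = F1 z ∧ F2 (z.1, -z.2) = -F2 z) ∧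
  ∀ z ∈ D, ∀ v ∈ S q, f (spt p q v z) = F1 z + ωCl p q ξ v * F2 z

/-- The generalized Cauchy–Riemann system (2.6) for the pair `(F1, F2)`. -/
def CRSystem (D : Set (Sl p)) (F1 F2 : Sl p → A) : Prop :=
  ∀ z ∈ D, DP p q ξ F1 z - pdr p F2 z = 0 ∧ DPbar p q ξ F2 z + pdr p F1 z = 0

/-- `f ∈ 𝒢𝒮ℛ(Ω_D)` with the given components. -/
def GSROnWith (D : Set (Sl p)) (f : V p q → A) (F1 F2 : Sl p → A) : Prop :=
  IsGPSlice p q ξ D f F1 F2 ∧ ContDiffOn ℝ 1 F1 D ∧ ContDiffOn ℝ 1 F2 D ∧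
    CRSystem p q ξ D F1 F2

/-- `f ∈ 𝒢𝒮ℛ(Ω_D)`. -/
def GSROn (D : Set (Sl p)) (f : V p q → A) : Prop :=
  ∃ F1 F2, GSROnWith p q ξ D f F1 F2

/-- Iterates `((1/r) ∂_r)^k F`. -/
def AIter (F : Sl p → A) : ℕ → Sl p → A
  | 0 => F
  | k + 1 => fun z => z.2⁻¹ • pdr p (AIter F k) z

/-- Iterates `(∂_r (1/r))^k F`. -/
def BIter (F : Sl p → A) : ℕ → Sl p → A
  | 0 => F
  | k + 1 => fun z => fderiv ℝ (fun w : Sl p => w.2⁻¹ • BIter F k w) z (0, 1)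

/-- `C_q(k) = (q-1)(q-3)⋯(q-2k+1)`. -/
def Cq (k : ℕ) : ℝ := ∏ j ∈ Finset.range k, ((q : ℝ) - (2 * (j : ℝ) + 1))

/-- The Fueter–Sce map `τ_q = (1/(q-1)!!) Δ^{(q-1)/2}` (for odd `q`). -/
def tauq (f : V p q → A) : V p q → A :=
  fun z => (((q - 1)‼ : ℝ))⁻¹ • (LapV p q)^[(q - 1) / 2] f z

/-- `(𝐱_q D_{𝐱_p})^k`, for a fixed Clifford element `u` in place of `𝐱_q`. -/
def uDpow (u : A) : ℕ → (Vp p → A) → Vp p → A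
  | 0 => fun g => g
  | k + 1 => fun g x => u * DPfun p q ξ (uDpow u k g) x

/-- The `k`-th term of the slice Cauchy–Kovalevskaya extension series. -/
def ckTerm (f₀ : Vp p → A) (k : ℕ) (z : V p q) : A :=
  ((k ! : ℝ))⁻¹ • uDpow p q ξ (ωCl p q ξ z.2) k f₀ z.1

/-- The slice Cauchy–Kovalevskaya extension `CK[f₀]`. -/
def CKext (f₀ : Vp p → A) (z : V p q) : A := ∑' k, ckTerm p q ξ f₀ k z

/-- The `k`-th term of the CK-extension for a fixed direction `w`. -/
def ckDirTerm (w : Vq q) (f₀ : Vp p → A) (k : ℕ) (z : V p q) : A :=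
  ((⟪w, z.2⟫) ^ k / (k ! : ℝ)) • uDpow p q ξ (ωCl p q ξ w) k f₀ z.1

/-- The CK-extension for a fixed direction `w ∈ 𝕊`. -/
def CKdir (w : Vq q) (f₀ : Vp p → A) (z : V p q) : A :=
  ∑' k, ckDirTerm p q ξ w f₀ k z

/-- The coefficients of the generalized CK-extension:
`f_{2k} = (Γ(q/2) / (2^{2k} k! Γ(k+q/2))) Δ^k f₀` and
`f_{2k+1} = (Γ(q/2) / (2^{2k+1} k! Γ(k+q/2+1))) D Δ^k f₀`. -/
def gckCoeff (f₀ : Vp p → A) (k : ℕ) : Vp p → A :=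
  if k % 2 = 0 then
    fun x => (Real.Gamma ((q : ℝ) / 2) /
        (2 ^ k * ((k / 2)! : ℝ) * Real.Gamma (((k / 2 : ℕ) : ℝ) + (q : ℝ) / 2))) •
      (LapP p)^[k / 2] f₀ x
  else
    fun x => (Real.Gamma ((q : ℝ) / 2) /
        (2 ^ k * ((k / 2)! : ℝ) * Real.Gamma (((k / 2 : ℕ) : ℝ) + (q : ℝ) / 2 + 1))) •
      DPfun p q ξ ((LapP p)^[k / 2] f₀) x

/-- The `k`-th term `𝐱_q^k f_k(𝐱_p)` of the generalized CK-extension series. -/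
def gckTerm (f₀ : Vp p → A) (k : ℕ) (z : V p q) : A :=
  (ωCl p q ξ z.2) ^ k * gckCoeff p q ξ f₀ k z.1

/-- The generalized CK-extension `GCK[f₀]`. -/
def GCKext (f₀ : Vp p → A) (z : V p q) : A := ∑' k, gckTerm p q ξ f₀ k z

/-- The Radon transform `R[f](𝐱_p, r, ω) = ∫_{⟨𝐱_q,ω⟩=r} f(𝐱_p, 𝐱_q) dσ(𝐱_q)`. -/
def radon (f : V p q → A) (x : Vp p) (r : ℝ) (w : Vq q) : A :=
  ∫ u : ((Submodule.span ℝ {w})ᗮ : Submodule ℝ (Vq q)),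
    f (x, r • w + (u : Vq q))

/-- The (suitably normalized) surface measure on the unit sphere of `ℝ^q`. -/
def sphMeasure : Measure (sphere (0 : Vq q) 1) := volume.toSphere

/-- The dual Radon transform
`Ř[f](𝐱_p, 𝐱_q) = (1/A_q) ∫_𝕊 f(𝐱_p, ⟨𝐱_q, η⟩ η) dS(η)` (a spherical average). -/
def dualRadon (f : V p q → A) (z : V p q) : A :=
  ⨍ w : sphere (0 : Vq q) 1,
    f (z.1, (⟪((w : Vq q)), z.2⟫) • (w : Vq q)) ∂(sphMeasure q)

end GPS

open GPS

instance finiteDimensional_cliffordAlgebra {n : ℕ} (Q : QuadraticForm ℝ (Fin n → ℝ)) :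
    FiniteDimensional ℝ (CliffordAlgebra Q) := by
  have : FiniteDimensional ℝ (ExteriorAlgebra ℝ (Fin n → ℝ)) :=
    Module.Basis.finiteDimensional_of_finite (Pi.basisFun ℝ (Fin n)).ExteriorAlgebra
  exact LinearEquiv.finiteDimensional (CliffordAlgebra.equivExterior Q).symm

section EllipticRegularity

variable {E : Type*} [NormedAddCommGroup E] [NormedSpace ℝ E] [FiniteDimensional ℝ E]
  {A : Type*} [NormedRing A] [NormedAlgebra ℝ A]
  {ι : Type*} [Fintype ι] [DecidableEq ι]

theorem integral_fderiv_smul_fderiv_comm [MeasurableSpace E] [BorelSpace E]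
    (μ : Measure E) [μ.IsAddHaarMeasure] {Φ : E → ℝ} (hΦ : ContDiff ℝ 2 Φ)
    (hΦc : HasCompactSupport Φ) {v : E → A} (hv : ContDiff ℝ 1 v) (a b : E) :
    ∫ y, fderiv ℝ Φ y a • fderiv ℝ v y b ∂μ = ∫ y, fderiv ℝ Φ y b • fderiv ℝ v y a ∂μ := by
  have hd (a : E) : ContDiff ℝ 1 (fun y => fderiv ℝ Φ y a) :=
    (hΦ.fderiv_right (m := 1) (by norm_num)).clm_apply contDiff_const
  have hdc (a : E) : HasCompactSupport (fun y => fderiv ℝ Φ y a) := hΦc.fderiv_apply ℝ a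
  have hvd (a : E) : Continuous (fun y => fderiv ℝ v y a) :=
    (hv.continuous_fderiv (by norm_num)).clm_apply continuous_const
  have key (a b : E) : ∫ y, fderiv ℝ Φ y a • fderiv ℝ v y b ∂μ
      = - ∫ y, fderiv ℝ (fun y => fderiv ℝ Φ y a) y b • v y ∂μ := by
    apply integral_smul_fderiv_eq_neg_fderiv_smul_of_integrable
    · exact ((((hd a).continuous_fderiv (by norm_num)).clm_apply continuous_const).smul
        hv.continuous).integrable_of_hasCompactSupport (((hdc a).fderiv_apply ℝ b).smul_right)
    · exact ((hd a).continuous.smul (hvd b)).integrable_of_hasCompactSupport (hdc a).smul_right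
    · exact ((hd a).continuous.smul hv.continuous).integrable_of_hasCompactSupport
        (hdc a).smul_right
    · exact fun x _ => (hd a).differentiable (by norm_num) x
    · exact fun x _ => hv.differentiable (by norm_num) x
  rw [key, key]
  congr 2
  ext y
  have hs : IsSymmSndFDerivAt ℝ Φ y := hΦ.contDiffAt.isSymmSndFDerivAt (by simp)
  have h2 (a b : E) : fderiv ℝ (fun y => fderiv ℝ Φ y a) y b = fderiv ℝ (fderiv ℝ Φ) y b a := by
    have : DifferentiableAt ℝ (fderiv ℝ Φ) y :=
      (hΦ.fderiv_right (m := 1) (by norm_num)).differentiable (by norm_num) y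
    rw [fderiv_clm_apply this (by fun_prop)]
    simp
  rw [h2, h2, hs.eq]

theorem sum_integral_fderiv_smul_fderiv_eq_zero [CompleteSpace A] [MeasurableSpace E] [BorelSpace E]
    (μ : Measure E) [μ.IsAddHaarMeasure] (b : ι → E) {c cb : ι → A}
    (hc : ∀ i j, cb i * c j + cb j * c i = if i = j then 2 else 0)
    {Φ : E → ℝ} (hΦ : ContDiff ℝ 2 Φ) (hΦc : HasCompactSupport Φ)
    {v : E → A} (hv : ContDiff ℝ 1 v)
    (h : ∀ y ∈ tsupport Φ, ∑ i, c i * fderiv ℝ v y (b i) = 0) :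
    ∑ i, ∫ y, fderiv ℝ Φ y (b i) • fderiv ℝ v y (b i) ∂μ = 0 := by
  set I : ι → ι → A := fun i j => ∫ y, fderiv ℝ Φ y (b i) • fderiv ℝ v y (b j) ∂μ with hI
  have hsymm (i j) : I i j = I j i := integral_fderiv_smul_fderiv_comm μ hΦ hΦc hv _ _
  have hint (i j) : Integrable (fun y => fderiv ℝ Φ y (b i) • fderiv ℝ v y (b j)) μ :=
    Continuous.integrable_of_hasCompactSupport
      (((hΦ.continuous_fderiv (by norm_num)).clm_apply continuous_const).smul
      ((hv.continuous_fderiv (by norm_num)).clm_apply continuous_const))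
      (hΦc.fderiv_apply ℝ _).smul_right
  have hrow (i) : ∑ j, c j * I i j = 0 := by
    have : ∑ j, c j * I i j
        = ∫ y, ∑ j, c j * (fderiv ℝ Φ y (b i) • fderiv ℝ v y (b j)) ∂μ := by
      rw [integral_finsetSum _ (fun j _ => (hint i j).const_mul _)]
      exact Finset.sum_congr rfl fun j _ =>
        ((ContinuousLinearMap.mul ℝ A (c j)).integral_comp_comm (hint i j)).symm
    rw [this]
    apply integral_eq_zero_of_ae
    refine Eventually.of_forall fun y => ?_
    simp only [mul_smul_comm, ← Finset.smul_sum, Pi.zero_apply]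
    by_cases hy : y ∈ tsupport Φ
    · rw [h y hy, smul_zero]
    · have : fderiv ℝ Φ y = 0 :=
        image_eq_zero_of_notMem_tsupport fun h => hy (tsupport_fderiv_subset ℝ h)
      simp [this]
  have h2 : (2 : ℝ) • ∑ i, I i i = ∑ i, ∑ j, (cb i * c j + cb j * c i) * I i j := by
    rw [Finset.smul_sum]
    refine Finset.sum_congr rfl fun i _ => ?_
    simp [hc, ite_mul, two_smul, two_mul]
  have h3 : ∑ i, ∑ j, (cb i * c j + cb j * c i) * I i j = 0 := by
    simp only [add_mul, Finset.sum_add_distrib]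
    rw [Finset.sum_comm (f := fun i j => cb j * c i * I i j)]
    simp only [hsymm _ _, mul_assoc, ← Finset.mul_sum]
    simp [hrow]
  rw [h3] at h2
  exact (smul_eq_zero.mp h2).resolve_left two_ne_zero

theorem exists_radial_potential [MeasurableSpace E] [BorelSpace E] (μ : Measure E)
    [μ.IsAddHaarMeasure] (b : Module.Basis ι ℝ E) :
    ∃ ψ Φ : E → ℝ, ContDiff ℝ (⊤ : ℕ∞) ψ ∧ HasCompactSupport ψ ∧ ContDiff ℝ 2 Φ ∧
      HasCompactSupport Φ ∧ (∀ y i, fderiv ℝ Φ y (b i) = ψ y * b.repr y i) ∧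
      ∫ y, ψ y ∂μ ≠ 0 := by
  let β : ContDiffBump (0 : ℝ) := ⟨1, 2, one_pos, one_lt_two⟩
  let η : ℝ → ℝ := fun s => ∫ σ in (2 : ℝ)..s, β σ / 2
  have hβc : Continuous fun σ => β σ / 2 := β.continuous.div_const 2
  have hη (s : ℝ) : HasDerivAt η (β s / 2) s :=
    intervalIntegral.integral_hasDerivAt_right (hβc.intervalIntegrable _ _)
      hβc.aestronglyMeasurable.stronglyMeasurableAtFilter hβc.continuousAt
  have hβ0 {s : ℝ} (hs : 2 ≤ s) : β s = 0 :=
    β.zero_of_le_dist (by simpa [β] using hs.trans (le_abs_self s))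
  have hη0 {s : ℝ} (hs : 2 ≤ s) : η s = 0 := by
    apply intervalIntegral.integral_zero_ae
    refine Eventually.of_forall fun σ hσ => ?_
    rw [Set.uIoc_of_le hs] at hσ
    simp [hβ0 hσ.1.le]
  have hηs : ContDiff ℝ (⊤ : ℕ∞) η := by
    rw [contDiff_infty_iff_deriv]
    refine ⟨fun s => (hη s).differentiableAt, ?_⟩
    rw [show deriv η = fun s => β s / 2 from funext fun s => (hη s).deriv]
    exact β.contDiff.div_const 2
  let L : ι → E →L[ℝ] ℝ := fun i => (b.coord i).toContinuousLinearMap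
  have hL (i : ι) (y : E) : L i y = b.repr y i := rfl
  let N : E → ℝ := fun y => ∑ i, L i y ^ 2
  have hNs : ContDiff ℝ (⊤ : ℕ∞) N :=
    ContDiff.sum fun i _ => (L i).contDiff.pow 2
  have hN (y : E) : HasFDerivAt N (∑ i, (2 * L i y) • L i) y := by
    have := HasFDerivAt.fun_sum (u := Finset.univ) fun i _ => ((L i).hasFDerivAt (x := y)).pow 2
    simpa using this
  let K : Set E := b.equivFunL.symm '' closedBall 0 2
  have hK : IsCompact K := (isCompact_closedBall 0 2).image b.equivFunL.symm.continuous
  have hNK {y : E} (hy : y ∉ K) : 2 ≤ N y := by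
    by_contra! hlt
    refine hy ⟨b.equivFunL y, ?_, by simp⟩
    rw [mem_closedBall_zero_iff, pi_norm_le_iff_of_nonneg two_pos.le]
    intro i
    have h1 : L i y ^ 2 ≤ N y :=
      Finset.single_le_sum (f := fun i => L i y ^ 2) (fun i _ => sq_nonneg _) (Finset.mem_univ i)
    have : (b.equivFunL y) i = L i y := rfl
    rw [this, Real.norm_eq_abs]
    exact abs_le_of_sq_le_sq (by linarith) two_pos.le
  have hψc : HasCompactSupport fun y => β (N y) := HasCompactSupport.intro hK fun y hy => hβ0 (hNK hy)
  have hψs : ContDiff ℝ (⊤ : ℕ∞) fun y => β (N y) := β.contDiff.comp hNs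
  refine ⟨fun y => β (N y), fun y => η (N y), hψs, hψc,
    contDiff_infty.mp (hηs.comp hNs) 2,
    HasCompactSupport.intro hK fun y hy => hη0 (hNK hy), fun y i => ?_, ?_⟩
  · have := ((hη (N y)).comp_hasFDerivAt y (hN y)).fderiv
    rw [show (fun y => η (N y)) = η ∘ N from rfl, this]
    have hb (j : ι) : L j (b i) = if i = j then 1 else 0 := by
      rw [hL, b.repr_self, Finsupp.single_apply]
    simp [hb, hL]
    ring
  · refine (hψs.continuous.integral_pos_of_hasCompactSupport_nonneg_nonzero hψc
      (fun y => β.nonneg) (x := 0) ?_).ne'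
    have : N 0 = 0 := by simp [N]
    simp only [this]
    rw [β.one_of_mem_closedBall (by simp [β])]
    exact one_ne_zero

variable [CompleteSpace A]

theorem contDiffAt_of_sum_mul_fderiv_eq_zero_of_hasCompactSupport (b : Module.Basis ι ℝ E)
    {c cb : ι → A} (hc : ∀ i j, cb i * c j + cb j * c i = if i = j then 2 else 0)
    {u : E → A} (hu : ContDiff ℝ 1 u) (huc : HasCompactSupport u) {x₀ : E} {ρ : ℝ} (hρ : 0 < ρ)
    (h : ∀ y ∈ ball x₀ ρ, ∑ i, c i * fderiv ℝ u y (b i) = 0) :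
    ContDiffAt ℝ (⊤ : ℕ∞) u x₀ := by
  borelize E
  let μ : Measure E := Measure.addHaar
  obtain ⟨ψ, Φ, hψ, hψc, hΦ, hΦc, hψΦ, hψ0⟩ := exists_radial_potential μ b
  obtain ⟨R, hR0, hR⟩ : ∃ R > 0, ∀ y ∈ tsupport Φ, ‖y‖ ≤ R := by
    obtain ⟨R, hR⟩ := hΦc.isCompact.isBounded.exists_norm_le
    exact ⟨max R 1, by positivity, fun y hy => (hR y hy).trans (le_max_left _ _)⟩
  set τ : ℝ := ρ / (2 * R) with hτ
  have hτ0 : 0 < τ := by positivity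
  have hfu : Continuous (fderiv ℝ u) := hu.continuous_fderiv (by norm_num)
  obtain ⟨C, hC⟩ := hfu.bounded_above_of_compact_support (huc.fderiv ℝ)
  let g : E → ℝ → A := fun x t => ∫ y, ψ y • u (x + t • y) ∂μ
  have hu' (x y : E) (t : ℝ) : HasDerivAt (fun t : ℝ => ψ y • u (x + t • y))
      (ψ y • fderiv ℝ u (x + t • y) y) t := by
    have h1 : HasDerivAt (fun t : ℝ => x + t • y) y t := by
      simpa using ((hasDerivAt_id t).smul_const y).const_add x
    exact ((hu.differentiable (by norm_num) _).hasFDerivAt.comp_hasDerivAt t h1).const_smul (ψ y)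
  have hcont (x : E) (t : ℝ) : Continuous fun y => ψ y • u (x + t • y) :=
    hψ.continuous.smul (hu.continuous.comp (by fun_prop))
  have hcont' (x : E) (t : ℝ) : Continuous fun y => ψ y • fderiv ℝ u (x + t • y) y :=
    hψ.continuous.smul ((hfu.comp (by fun_prop)).clm_apply continuous_id)
  have hg (x : E) (t : ℝ) : HasDerivAt (g x) (∫ y, ψ y • fderiv ℝ u (x + t • y) y ∂μ) t := by
    refine (hasDerivAt_integral_of_dominated_loc_of_deriv_le (μ := μ) (𝕜 := ℝ)
      (F := fun t y => ψ y • u (x + t • y)) (F' := fun t y => ψ y • fderiv ℝ u (x + t • y) y)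
      (bound := fun y => ‖ψ y‖ * (C * ‖y‖)) (s := Set.univ) univ_mem ?_ ?_ ?_ ?_ ?_ ?_).2
    · exact Eventually.of_forall fun t => (hcont x t).aestronglyMeasurable
    · exact (hcont x t).integrable_of_hasCompactSupport hψc.smul_right
    · exact (hcont' x t).aestronglyMeasurable
    · refine Eventually.of_forall fun y t _ => ?_
      rw [norm_smul]
      gcongr
      exact (ContinuousLinearMap.le_opNorm _ _).trans (by gcongr; exact hC _)
    · refine Continuous.integrable_of_hasCompactSupport ?_ hψc.norm.mul_right
      exact hψ.continuous.norm.mul (by fun_prop)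
    · exact Eventually.of_forall fun y t _ => hu' x y t
  have hg0 (x : E) (hx : x ∈ ball x₀ (ρ / 2)) (t : ℝ) (ht : t ∈ Set.Ico 0 τ) :
      ∫ y, ψ y • fderiv ℝ u (x + t • y) y ∂μ = 0 := by
    obtain ⟨v, hv, hvu⟩ : ∃ v : E → A, ContDiff ℝ 1 v ∧
        ∀ y, fderiv ℝ v y = fderiv ℝ u (x + t • y) := by
      rcases eq_or_ne t 0 with rfl | ht0
      · exact ⟨fderiv ℝ u x, (fderiv ℝ u x).contDiff, fun y => by simp⟩
      · refine ⟨fun y => t⁻¹ • u (x + t • y), by fun_prop, fun y => ?_⟩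
        have h1 : HasFDerivAt (fun y => x + t • y) (t • ContinuousLinearMap.id ℝ E) y :=
          ((hasFDerivAt_id y).const_smul t).const_add x
        refine (((hu.differentiable (by norm_num) _).hasFDerivAt.comp y h1).const_smul
          t⁻¹).fderiv.trans ?_
        ext z
        simp [ht0]
    have key := sum_integral_fderiv_smul_fderiv_eq_zero μ b hc hΦ hΦc hv fun y hy => by
      rw [hvu]
      refine h _ ?_
      have h2 : ‖t • y‖ ≤ ρ / 2 := by
        rw [norm_smul, Real.norm_of_nonneg ht.1]
        calc t * ‖y‖ ≤ τ * R := by gcongr; exacts [ht.2.le, hR y hy]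
          _ = ρ / 2 := by rw [hτ]; field_simp
      rw [mem_ball_iff_norm] at hx ⊢
      calc ‖x + t • y - x₀‖ = ‖(x - x₀) + t • y‖ := by congr 1; abel
        _ ≤ ‖x - x₀‖ + ‖t • y‖ := norm_add_le _ _
        _ < ρ := by linarith
    rw [← key, ← integral_finsetSum]
    · congr 1
      ext y
      simp only [hvu, hψΦ, mul_smul, ← Finset.smul_sum, ← map_smul, ← map_sum, b.sum_repr]
    · intro i _
      exact Continuous.integrable_of_hasCompactSupport
        (((hΦ.continuous_fderiv (by norm_num)).clm_apply continuous_const).smul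
        ((hv.continuous_fderiv (by norm_num)).clm_apply continuous_const))
        (hΦc.fderiv_apply ℝ _).smul_right
  have hmean (x : E) (hx : x ∈ ball x₀ (ρ / 2)) : g x τ = (∫ y, ψ y ∂μ) • u x := by
    rw [constant_of_has_deriv_right_zero (f := g x) (a := 0) (b := τ)
      (fun t _ => (hg x t).continuousAt.continuousWithinAt)
      (fun t ht => by simpa only [hg0 x hx t ht] using (hg x t).hasDerivWithinAt) τ
      ⟨hτ0.le, le_rfl⟩]
    simp [g, integral_smul_const]
  have hsmooth : ContDiff ℝ (⊤ : ℕ∞) fun x => g x τ := by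
    let u₁ : E → A := fun z => u (τ • z)
    have hu₁ : LocallyIntegrable u₁ μ :=
      (hu.continuous.comp (by fun_prop : Continuous fun z : E => τ • z)).locallyIntegrable
    have hψn : HasCompactSupport fun y => ψ (-y) := hψc.comp_homeomorph (Homeomorph.neg E)
    have hconv := hψn.contDiff_convolution_left (𝕜 := ℝ) (n := ⊤) (ContinuousLinearMap.lsmul ℝ ℝ)
      (hψ.comp contDiff_neg) hu₁
    have heq : (fun x => g x τ) = fun x => (convolution (fun y => ψ (-y)) u₁
        (ContinuousLinearMap.lsmul ℝ ℝ) μ) (τ⁻¹ • x) := by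
      ext x
      rw [convolution, ← integral_neg_eq_self]
      simp [g, u₁, smul_add, smul_smul, hτ0.ne']
    rw [heq]
    exact hconv.comp (by fun_prop)
  have heq : u =ᶠ[𝓝 x₀] fun x => (∫ y, ψ y ∂μ)⁻¹ • g x τ := by
    filter_upwards [ball_mem_nhds x₀ (half_pos hρ)] with x hx
    rw [hmean x hx, smul_smul, inv_mul_cancel₀ hψ0, one_smul]
  exact (hsmooth.const_smul _).contDiffAt.congr_of_eventuallyEq heq

/-- A `C¹` solution of a first-order system `∑ cᵢ ∂ᵢ u = 0` of Cauchy–Riemann type is smooth. -/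
theorem contDiffOn_of_sum_mul_fderiv_eq_zero (b : Module.Basis ι ℝ E)
    {c cb : ι → A} (hc : ∀ i j, cb i * c j + cb j * c i = if i = j then 2 else 0)
    {u : E → A} {U : Set E} (hU : IsOpen U) (hu : ContDiffOn ℝ 1 u U)
    (h : ∀ y ∈ U, ∑ i, c i * fderiv ℝ u y (b i) = 0) :
    ContDiffOn ℝ (⊤ : ℕ∞) u U := by
  intro x₀ hx₀
  obtain ⟨ρ, hρ, hρU⟩ := Metric.nhds_basis_closedBall.mem_iff.mp (hU.mem_nhds hx₀)
  let χ : ContDiffBump x₀ := ⟨ρ / 2, ρ, half_pos hρ, half_lt_self hρ⟩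
  have hχs : tsupport χ ⊆ U := by rw [χ.tsupport_eq]; exact hρU
  have heq {x : E} (hx : x ∈ ball x₀ (ρ / 2)) : (fun x => χ x • u x) =ᶠ[𝓝 x] u := by
    filter_upwards [isOpen_ball.mem_nhds hx] with y hy
    rw [χ.one_of_mem_closedBall (ball_subset_closedBall hy), one_smul]
  have hw : ContDiff ℝ 1 fun x => χ x • u x := by
    rw [contDiff_iff_contDiffAt]
    intro x
    by_cases hx : x ∈ tsupport χ
    · exact χ.contDiff.contDiffAt.smul (hu.contDiffAt (hU.mem_nhds (hχs hx)))
    · refine contDiffAt_const (c := (0 : A)) |>.congr_of_eventuallyEq ?_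
      filter_upwards [(isClosed_tsupport _).isOpen_compl.mem_nhds hx] with y hy
      rw [image_eq_zero_of_notMem_tsupport hy, zero_smul]
  refine ContDiffAt.contDiffWithinAt (ContDiffAt.congr_of_eventuallyEq ?_
    (heq (mem_ball_self (half_pos hρ))).symm)
  refine contDiffAt_of_sum_mul_fderiv_eq_zero_of_hasCompactSupport b hc hw
    χ.hasCompactSupport.smul_right (half_pos hρ) fun y hy => ?_
  rw [(heq hy).fderiv_eq]
  exact h y (hρU (ball_subset_closedBall (ball_subset_ball (by linarith) hy)))

end EllipticRegularity

section RadialDivision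

variable {X F : Type*} [NormedAddCommGroup X] [NormedSpace ℝ X]
  [NormedAddCommGroup F] [NormedSpace ℝ F]

theorem contDiff_intervalIntegral_zero_one [CompleteSpace F] {w : X × ℝ → F} (hw : ContDiff ℝ (⊤ : ℕ∞) w) :
    ContDiff ℝ (⊤ : ℕ∞) fun y => ∫ s in (0 : ℝ)..1, w (y, s) := by
  let β : ContDiffBump (0 : ℝ) := ⟨1, 2, one_pos, one_lt_two⟩
  let f : ℝ → ℝ := (Set.Ico (-1) 0).indicator 1
  have hf : LocallyIntegrable f :=
    ((integrable_indicator_iff measurableSet_Ico).2 (integrableOn_const (by simp))).locallyIntegrable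
  have hg : ContDiffOn ℝ (⊤ : ℕ∞) ↿(fun (y : X) (s : ℝ) => β s • w (y, s))
      (Set.univ ×ˢ Set.univ) := by
    have : ContDiff ℝ (⊤ : ℕ∞) fun z : X × ℝ => β z.2 • w (z.1, z.2) :=
      (β.contDiff.comp contDiff_snd).smul hw
    exact this.contDiffOn
  have key := contDiffOn_convolution_left_with_param_comp (μ := volume)
    (ContinuousLinearMap.lsmul ℝ ℝ : ℝ →L[ℝ] F →L[ℝ] F).flip
    (contDiffOn_const (c := (0 : ℝ)) : ContDiffOn ℝ (⊤ : ℕ∞) (fun _ : X => (0 : ℝ)) Set.univ)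
    isOpen_univ (isCompact_closedBall (0 : ℝ) 2)
    (fun y s _ hs => by
      rw [β.zero_of_le_dist (by simpa [β] using (not_le.1 (mt mem_closedBall.2 hs)).le), zero_smul])
    hf hg
  rw [contDiffOn_univ] at key
  convert key using 2 with y
  rw [convolution, intervalIntegral.integral_of_le zero_le_one, ← integral_indicator measurableSet_Ioc]
  congr 1
  ext s
  by_cases hs : s ∈ Set.Ioc (0 : ℝ) 1
  · have h1 : (0 - s) ∈ Set.Ico (-1 : ℝ) 0 := ⟨by linarith [hs.2], by linarith [hs.1]⟩
    have h2 : β s = 1 := β.one_of_mem_closedBall (by simp [β, abs_of_pos hs.1, hs.2])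
    simp only [f, Set.indicator_of_mem hs, ContinuousLinearMap.flip_apply,
      ContinuousLinearMap.lsmul_apply, Set.indicator_of_mem h1, h2, Pi.one_apply, one_smul]
  · have h1 : (0 - s) ∉ Set.Ico (-1 : ℝ) 0 := fun h => hs ⟨by linarith [h.2], by linarith [h.1]⟩
    simp only [f, Set.indicator_of_notMem hs, ContinuousLinearMap.flip_apply,
      ContinuousLinearMap.lsmul_apply, Set.indicator_of_notMem h1, zero_smul]

theorem ContDiffOn.fderiv_apply_const {D : Set X} (hD : IsOpen D) {H : X → F}
    (hH : ContDiffOn ℝ (⊤ : ℕ∞) H D) (v : X) :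
    ContDiffOn ℝ (⊤ : ℕ∞) (fun z => fderiv ℝ H z v) D :=
  (hH.fderiv_of_isOpen hD (m := (⊤ : ℕ∞)) (by simp)).clm_apply contDiffOn_const

/-- Hadamard's lemma: a smooth function vanishing on `{r = 0}` is `r` times a smooth function. -/
theorem exists_contDiffOn_eq_smul [CompleteSpace F] [FiniteDimensional ℝ X] {D : Set (X × ℝ)} (hD : IsOpen D)
    {H : X × ℝ → F} (hH : ContDiffOn ℝ (⊤ : ℕ∞) H D) (h0 : ∀ x, (x, (0 : ℝ)) ∈ D → H (x, 0) = 0) :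
    ∃ K : X × ℝ → F, ContDiffOn ℝ (⊤ : ℕ∞) K D ∧ ∀ z ∈ D, H z = z.2 • K z := by
  classical
  let H' : X × ℝ → F := fun z => fderiv ℝ H z (0, 1)
  have hH' : ContDiffOn ℝ (⊤ : ℕ∞) H' D := hH.fderiv_apply_const hD _
  let K : X × ℝ → F := fun z => if z.2 = 0 then H' z else z.2⁻¹ • H z
  refine ⟨K, fun z₀ hz₀ => ?_, fun z hz => ?_⟩
  swap
  · by_cases h : z.2 = 0
    · have : H z = 0 := by
        have h1 : z = (z.1, 0) := by rw [← h]
        rw [h1] at hz ⊢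
        exact h0 _ hz
      rw [this, h, zero_smul]
    · simp [K, h]
  by_cases h : z₀.2 = 0
  swap
  · refine ContDiffWithinAt.congr_of_eventuallyEq (f := fun z => z.2⁻¹ • H z)
      ((contDiffWithinAt_snd.inv h).smul (hH z₀ hz₀)) ?_ (by simp [K, h])
    have : ∀ᶠ z : X × ℝ in 𝓝 z₀, z.2 ≠ 0 := continuousAt_snd.eventually_ne h
    filter_upwards [nhdsWithin_le_nhds this] with z hz
    simp [K, hz]
  obtain ⟨ρ, hρ, hρD⟩ := Metric.nhds_basis_closedBall.mem_iff.mp (hD.mem_nhds hz₀)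
  let χ : ContDiffBump z₀ := ⟨ρ / 2, ρ, half_pos hρ, half_lt_self hρ⟩
  have hχs : tsupport χ ⊆ D := by rw [χ.tsupport_eq]; exact hρD
  have hw : ContDiff ℝ (⊤ : ℕ∞) fun z => χ z • H' z := by
    rw [contDiff_iff_contDiffAt]
    intro x
    by_cases hx : x ∈ tsupport χ
    · exact χ.contDiff.contDiffAt.smul (hH'.contDiffAt (hD.mem_nhds (hχs hx)))
    · refine contDiffAt_const (c := (0 : F)) |>.congr_of_eventuallyEq ?_
      filter_upwards [(isClosed_tsupport _).isOpen_compl.mem_nhds hx] with y hy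
      rw [image_eq_zero_of_notMem_tsupport hy, zero_smul]
  let w : X × ℝ → F := fun z => χ z • H' z
  have hwc : ContDiff ℝ (⊤ : ℕ∞) fun y : (X × ℝ) × ℝ => w (y.1.1, y.2 * y.1.2) :=
    hw.comp (by fun_prop)
  refine ((contDiff_intervalIntegral_zero_one hwc).contDiffAt.congr_of_eventuallyEq
    ?_).contDiffWithinAt
  filter_upwards [ball_mem_nhds z₀ (half_pos hρ)] with z hz
  have hseg {s : ℝ} (hs : s ∈ Set.Icc (0 : ℝ) 1) : (z.1, s * z.2) ∈ ball z₀ (ρ / 2) := by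
    rw [mem_ball_iff_norm] at hz ⊢
    refine lt_of_le_of_lt ?_ hz
    rw [Prod.norm_def, Prod.norm_def]
    refine max_le_max le_rfl ?_
    simp only [Prod.snd_sub, h, sub_zero, norm_mul]
    rw [Real.norm_of_nonneg hs.1]
    exact mul_le_of_le_one_left (norm_nonneg _) hs.2
  have hwH {s : ℝ} (hs : s ∈ Set.Icc (0 : ℝ) 1) : w (z.1, s * z.2) = H' (z.1, s * z.2) := by
    simp only [w]
    rw [χ.one_of_mem_closedBall (ball_subset_closedBall (hseg hs)), one_smul]
  have hDs {s : ℝ} (hs : s ∈ Set.Icc (0 : ℝ) 1) : (z.1, s * z.2) ∈ D :=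
    hρD (ball_subset_closedBall (ball_subset_ball (half_le_self hρ.le) (hseg hs)))
  by_cases hz0 : z.2 = 0
  · have := hwH (s := 0) (by simp)
    rw [zero_mul] at this
    have hz' : z = (z.1, 0) := by rw [← hz0]
    simp only [K, hz0, if_true, mul_zero, this, intervalIntegral.integral_const, sub_zero, one_smul]
    rw [← hz']
  · have hderiv : ∀ s ∈ Set.uIcc (0 : ℝ) 1,
        HasDerivAt (fun s : ℝ => H (z.1, s * z.2)) (z.2 • w (z.1, s * z.2)) s := by
      intro s hs
      rw [Set.uIcc_of_le zero_le_one] at hs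
      have h1 : HasDerivAt (fun s : ℝ => (z.1, s * z.2)) ((0 : X), z.2) s :=
        (hasDerivAt_const s z.1).prodMk (by simpa using (hasDerivAt_id s).mul_const z.2)
      have h2 := ((hH.contDiffAt (hD.mem_nhds (hDs hs))).differentiableAt
        (by simp)).hasFDerivAt.comp_hasDerivAt s h1
      rw [hwH hs]
      refine h2.congr_deriv ?_
      rw [← map_smul]
      simp
    have hint := intervalIntegral.integral_eq_sub_of_hasDerivAt hderiv
      (Continuous.intervalIntegrable (continuous_const.smul
        (hw.continuous.comp (by fun_prop))) _ _)
    rw [intervalIntegral.integral_smul] at hint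
    have hz1 : H (z.1, 0 * z.2) = 0 := by
      have := hDs (s := 0) (by simp)
      rw [zero_mul] at this ⊢
      exact h0 _ this
    rw [hz1, sub_zero, one_mul] at hint
    simp only [K, hz0, if_false]
    rw [show H z = H (z.1, z.2) from rfl, ← hint, smul_smul, inv_mul_cancel₀ hz0, one_smul]

end RadialDivision

section RadialCalculus

variable {p q : ℕ} {F' : Type*} [NormedAddCommGroup F'] [NormedSpace ℝ F']

/-- Smooth functions on `D ⊆ ℝ^{p+2}` that are even in the last variable. -/
structure SmoothEvenOn (D : Set (Sl p)) (F : Sl p → F') : Prop where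
  smooth : ContDiffOn ℝ (⊤ : ℕ∞) F D
  even : ∀ z ∈ D, F (z.1, -z.2) = F z

/-- `H = (1/r) ∂_r F` on `D`, in a form that makes sense at `r = 0`. -/
def IsRadDerivOn (D : Set (Sl p)) (F H : Sl p → F') : Prop :=
  ∀ z ∈ D, pdr p F z = z.2 • H z

theorem hasFDerivAt_reflection (z : Sl p) :
    HasFDerivAt (fun z : Sl p => ((z.1, -z.2) : Sl p))
      ((ContinuousLinearMap.fst ℝ (Vp p) ℝ).prod (-ContinuousLinearMap.snd ℝ (Vp p) ℝ)) z :=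
  ((ContinuousLinearMap.fst ℝ (Vp p) ℝ).prod
    (-ContinuousLinearMap.snd ℝ (Vp p) ℝ)).hasFDerivAt

variable {D : Set (Sl p)} (hD : IsOpen D)

include hD

theorem eqOn_of_smul_eqOn {H K : Sl p → F'} (hH : ContinuousOn H D) (hK : ContinuousOn K D)
    (h : ∀ z ∈ D, z.2 • H z = z.2 • K z) : Set.EqOn H K D := by
  intro z hz
  by_cases hz0 : z.2 = 0
  swap
  · exact smul_right_injective F' hz0 (h z hz)
  let c : ℝ → Sl p := fun t => (z.1, t)
  have hc : Continuous c := by fun_prop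
  have hc0 : c 0 = z := by simp only [c]; rw [← hz0]
  have hlim {G : Sl p → F'} (hG : ContinuousOn G D) :
      Tendsto (fun t => G (c t)) (𝓝[≠] 0) (𝓝 (G z)) := by
    have h1 : Tendsto c (𝓝[≠] 0) (𝓝 z) := by
      have := hc.tendsto 0
      rw [hc0] at this
      exact this.mono_left nhdsWithin_le_nhds
    exact (hG.continuousAt (hD.mem_nhds hz)).tendsto.comp h1
  refine tendsto_nhds_unique (hlim hH) ((hlim hK).congr' ?_)
  have h1 : ∀ᶠ t in 𝓝[≠] (0 : ℝ), c t ∈ D :=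
    nhdsWithin_le_nhds (hc.continuousAt.eventually_mem (by rw [hc0]; exact hD.mem_nhds hz))
  filter_upwards [h1, self_mem_nhdsWithin] with t ht ht0
  exact (smul_right_injective F' ht0 (h _ ht)).symm

namespace SmoothEvenOn

theorem differentiableAt {F : Sl p → F'} (hF : SmoothEvenOn D F) {z : Sl p} (hz : z ∈ D) :
    DifferentiableAt ℝ F z :=
  (hF.smooth.contDiffAt (hD.mem_nhds hz)).differentiableAt (by simp)

theorem fderiv_reflection {F : Sl p → F'} (hF : SmoothEvenOn D F) (hDr : ReflInv p D) {z : Sl p}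
    (hz : z ∈ D) (a : Vp p) (t : ℝ) :
    fderiv ℝ F (z.1, -z.2) (a, -t) = fderiv ℝ F z (a, t) := by
  have h1 := ((hF.differentiableAt hD (hDr z hz)).hasFDerivAt.comp z (hasFDerivAt_reflection z))
  have h2 : F =ᶠ[𝓝 z] F ∘ fun z : Sl p => ((z.1, -z.2) : Sl p) := by
    filter_upwards [hD.mem_nhds hz] with w hw
    exact (hF.even w hw).symm
  rw [h2.fderiv_eq, h1.fderiv]
  simp

theorem pdSl {F : Sl p → F'} (hF : SmoothEvenOn D F) (hDr : ReflInv p D) (i : Fin (p + 1)) :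
    SmoothEvenOn D (pdSl p i F) where
  smooth := hF.smooth.fderiv_apply_const hD _
  even z hz := by
    have := hF.fderiv_reflection hD hDr hz (Pi.single i 1) 0
    rw [neg_zero] at this
    exact this

theorem pdr_neg {F : Sl p → F'} (hF : SmoothEvenOn D F) (hDr : ReflInv p D) {z : Sl p}
    (hz : z ∈ D) : pdr p F (z.1, -z.2) = - pdr p F z := by
  have := hF.fderiv_reflection hD hDr hz 0 1
  rw [show ((0 : Vp p), (-1 : ℝ)) = -((0 : Vp p), (1 : ℝ)) by simp, map_neg] at this
  exact neg_eq_iff_eq_neg.1 this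

theorem of_smul_eq_odd {H K : Sl p → F'} (hDr : ReflInv p D) (hK : ContDiffOn ℝ (⊤ : ℕ∞) K D)
    (hodd : ∀ z ∈ D, H (z.1, -z.2) = - H z) (hHK : ∀ z ∈ D, H z = z.2 • K z) :
    SmoothEvenOn D K := by
  refine ⟨hK, ?_⟩
  refine eqOn_of_smul_eqOn hD (hK.continuousOn.comp (by fun_prop) fun z hz => hDr z hz)
    hK.continuousOn fun z hz => ?_
  rw [← hHK z hz, ← neg_neg (H z), ← hodd z hz, hHK _ (hDr z hz)]
  simp

theorem exists_eq_smul [CompleteSpace F'] {H : Sl p → F'} (hDr : ReflInv p D)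
    (hH : ContDiffOn ℝ (⊤ : ℕ∞) H D) (hodd : ∀ z ∈ D, H (z.1, -z.2) = - H z) :
    ∃ K, SmoothEvenOn D K ∧ ∀ z ∈ D, H z = z.2 • K z := by
  obtain ⟨K, hK, hHK⟩ := exists_contDiffOn_eq_smul hD hH fun x hx => by
    have h1 : H (x, 0) = - H (x, 0) := by simpa using hodd _ hx
    have h2 : (2 : ℝ) • H (x, 0) = 0 := by
      rw [two_smul]
      nth_rw 1 [h1]
      exact neg_add_cancel _
    exact (smul_eq_zero.1 h2).resolve_left two_ne_zero
  exact ⟨K, of_smul_eq_odd hD hDr hK hodd hHK, hHK⟩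

theorem exists_radDeriv [CompleteSpace F'] {F : Sl p → F'} (hF : SmoothEvenOn D F)
    (hDr : ReflInv p D) : ∃ H, SmoothEvenOn D H ∧ IsRadDerivOn D F H :=
  exists_eq_smul hD hDr (hF.smooth.fderiv_apply_const hD _) fun _ hz => hF.pdr_neg hD hDr hz

end SmoothEvenOn

theorem IsRadDerivOn.unique {F₁ F₂ H₁ H₂ : Sl p → F'} (h₁ : IsRadDerivOn D F₁ H₁)
    (h₂ : IsRadDerivOn D F₂ H₂) (hF : Set.EqOn F₁ F₂ D) (hH₁ : SmoothEvenOn D H₁)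
    (hH₂ : SmoothEvenOn D H₂) : Set.EqOn H₁ H₂ D := by
  refine eqOn_of_smul_eqOn hD hH₁.smooth.continuousOn hH₂.smooth.continuousOn fun z hz => ?_
  rw [← h₁ z hz, ← h₂ z hz, pdr, pdr, (hF.eventuallyEq_of_mem (hD.mem_nhds hz)).fderiv_eq]

theorem fderiv_fderiv_apply_comm {F : Sl p → F'} (hF : ContDiffOn ℝ (⊤ : ℕ∞) F D) {z : Sl p}
    (hz : z ∈ D) (a b : Sl p) :
    fderiv ℝ (fun w => fderiv ℝ F w a) z b = fderiv ℝ (fun w => fderiv ℝ F w b) z a := by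
  have hc : ContDiffAt ℝ (⊤ : ℕ∞) F z := hF.contDiffAt (hD.mem_nhds hz)
  have hs : IsSymmSndFDerivAt ℝ F z :=
    (contDiffAt_infty.1 hc 2).isSymmSndFDerivAt (by simp)
  have h2 (a b : Sl p) :
      fderiv ℝ (fun y => fderiv ℝ F y a) z b = fderiv ℝ (fderiv ℝ F) z b a := by
    have : DifferentiableAt ℝ (fderiv ℝ F) z :=
      (hc.fderiv_right (m := (⊤ : ℕ∞)) (by simp)).differentiableAt (by simp)
    rw [fderiv_clm_apply this (by fun_prop)]
    simp
  rw [h2, h2, hs.eq]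

theorem IsRadDerivOn.pdSl {F H : Sl p → F'} (h : IsRadDerivOn D F H) (hF : SmoothEvenOn D F)
    (hH : SmoothEvenOn D H) (i : Fin (p + 1)) : IsRadDerivOn D (pdSl p i F) (pdSl p i H) := by
  intro z hz
  have h1 : pdr p (GPS.pdSl p i F) z = GPS.pdSl p i (pdr p F) z :=
    fderiv_fderiv_apply_comm hD hF.smooth hz _ _
  have h2 : pdr p F =ᶠ[𝓝 z] fun z => z.2 • H z :=
    Set.EqOn.eventuallyEq_of_mem h (hD.mem_nhds hz)
  have h3 : HasFDerivAt (fun z : Sl p => z.2 • H z) _ z :=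
    hasFDerivAt_snd.smul (hH.differentiableAt hD hz).hasFDerivAt
  rw [h1, GPS.pdSl, h2.fderiv_eq, h3.fderiv]
  simp [GPS.pdSl]

end RadialCalculus

section AxialDirac

variable {p : ℕ} {A : Type*} [NormedRing A] [NormedAlgebra ℝ A] {D : Set (Sl p)}

/-- The constant coefficient operator `∑ c_i ∂_{x_i}` on functions on `ℝ^{p+2}`. -/
def axialDirac (c : Fin (p + 1) → A) (F : Sl p → A) : Sl p → A :=
  fun z => ∑ i, c i * pdSl p i F z

theorem SmoothEvenOn.smul_add_sq_smul {F G : Sl p → A} (hF : SmoothEvenOn D F)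
    (hG : SmoothEvenOn D G) (a : ℝ) : SmoothEvenOn D fun z => a • F z + z.2 ^ 2 • G z where
  smooth := (hF.smooth.const_smul a).add ((contDiffOn_snd.pow 2).smul hG.smooth)
  even z hz := by
    dsimp only
    rw [hF.even z hz, hG.even z hz, neg_sq]

theorem SmoothEvenOn.neg {F : Sl p → A} (hF : SmoothEvenOn D F) :
    SmoothEvenOn D fun z => - F z :=
  ⟨hF.smooth.neg, fun z hz => by rw [hF.even z hz]⟩

variable (hD : IsOpen D)

include hD

omit hD in
theorem IsRadDerivOn.neg {F H : Sl p → A} (h : IsRadDerivOn D F H) :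
    IsRadDerivOn D (fun z => - F z) fun z => - H z := by
  intro z hz
  have : fderiv ℝ (fun z => - F z) z = - fderiv ℝ F z := fderiv_fun_neg
  rw [pdr, this, neg_apply, smul_neg]
  exact congrArg _ (h z hz)

theorem hasFDerivAt_smul_add_sq_smul {F G : Sl p → A} (hF : SmoothEvenOn D F)
    (hG : SmoothEvenOn D G) (a : ℝ) {z : Sl p} (hz : z ∈ D) :
    HasFDerivAt (fun z => a • F z + z.2 ^ 2 • G z)
      (a • fderiv ℝ F z + (z.2 ^ 2 • fderiv ℝ G z +
        ((2 * z.2) • ContinuousLinearMap.snd ℝ (Vp p) ℝ).smulRight (G z))) z := by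
  refine ((hF.differentiableAt hD hz).hasFDerivAt.const_smul a).add ?_
  refine HasFDerivAt.smul (c := fun z : Sl p => z.2 ^ 2) ?_ (hG.differentiableAt hD hz).hasFDerivAt
  refine ((hasFDerivAt_snd (𝕜 := ℝ) (p := z)).pow 2).congr_fderiv ?_
  simp

theorem IsRadDerivOn.smul_add_sq_smul {F F₁ F₂ : Sl p → A} (h : IsRadDerivOn D F F₁)
    (h₁ : IsRadDerivOn D F₁ F₂) (hF : SmoothEvenOn D F) (hF₁ : SmoothEvenOn D F₁) (a : ℝ) :
    IsRadDerivOn D (fun z => a • F z + z.2 ^ 2 • F₁ z)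
      fun z => (a + 2) • F₁ z + z.2 ^ 2 • F₂ z := by
  intro z hz
  have e1 : fderiv ℝ F z (0, 1) = z.2 • F₁ z := h z hz
  have e2 : fderiv ℝ F₁ z (0, 1) = z.2 • F₂ z := h₁ z hz
  rw [pdr, (hasFDerivAt_smul_add_sq_smul hD hF hF₁ a hz).fderiv]
  simp only [add_apply, smul_apply, e1, e2,
    ContinuousLinearMap.smulRight_apply, ContinuousLinearMap.coe_snd']
  simp only [smul_add, smul_smul, add_smul, smul_eq_mul, mul_one]
  rw [show z.2 * 2 = 2 * z.2 by ring, show z.2 ^ 2 * z.2 = z.2 * z.2 ^ 2 by ring, mul_comm a]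
  abel

theorem axialDirac_smul_add_sq_smul {F G : Sl p → A} (hF : SmoothEvenOn D F)
    (hG : SmoothEvenOn D G) (a : ℝ) (c : Fin (p + 1) → A) {z : Sl p} (hz : z ∈ D) :
    axialDirac c (fun z => a • F z + z.2 ^ 2 • G z) z
      = a • axialDirac c F z + z.2 ^ 2 • axialDirac c G z := by
  simp only [axialDirac, pdSl, (hasFDerivAt_smul_add_sq_smul hD hF hG a hz).fderiv,
    Finset.smul_sum, ← Finset.sum_add_distrib]
  refine Finset.sum_congr rfl fun i _ => ?_
  simp [mul_add]

omit hD in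
theorem axialDirac_neg {F : Sl p → A} (c : Fin (p + 1) → A) (z : Sl p) :
    axialDirac c (fun z => - F z) z = - axialDirac c F z := by
  have (z : Sl p) : fderiv ℝ (fun z => - F z) z = - fderiv ℝ F z := fderiv_fun_neg
  simp [axialDirac, pdSl, this]

theorem axialDirac_congr {F G : Sl p → A} (h : Set.EqOn F G D) (c : Fin (p + 1) → A) {z : Sl p}
    (hz : z ∈ D) : axialDirac c F z = axialDirac c G z := by
  simp only [axialDirac, pdSl, (h.eventuallyEq_of_mem (hD.mem_nhds hz)).fderiv_eq]

theorem SmoothEvenOn.axialDirac {F : Sl p → A} (hF : SmoothEvenOn D F) (hDr : ReflInv p D)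
    (c : Fin (p + 1) → A) : SmoothEvenOn D (axialDirac c F) where
  smooth := ContDiffOn.sum fun i _ => contDiffOn_const.mul (hF.pdSl hD hDr i).smooth
  even z hz := by simp only [_root_.axialDirac, (hF.pdSl hD hDr _).even z hz]

theorem hasFDerivAt_axialDirac {F : Sl p → A} (hF : SmoothEvenOn D F) (hDr : ReflInv p D)
    (c : Fin (p + 1) → A) {z : Sl p} (hz : z ∈ D) :
    HasFDerivAt (axialDirac c F) (∑ i, c i • fderiv ℝ (pdSl p i F) z) z := by
  refine HasFDerivAt.fun_sum fun i _ => ?_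
  exact ((hF.pdSl hD hDr i).differentiableAt hD hz).hasFDerivAt.const_mul (c i)

theorem IsRadDerivOn.axialDirac {F H : Sl p → A} (h : IsRadDerivOn D F H) (hDr : ReflInv p D)
    (hF : SmoothEvenOn D F) (hH : SmoothEvenOn D H) (c : Fin (p + 1) → A) :
    IsRadDerivOn D (axialDirac c F) (axialDirac c H) := by
  intro z hz
  have e (i) : fderiv ℝ (GPS.pdSl p i F) z (0, 1) = z.2 • GPS.pdSl p i H z := h.pdSl hD hF hH i z hz
  rw [pdr, (hasFDerivAt_axialDirac hD hF hDr c hz).fderiv]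
  simp [e, _root_.axialDirac, Finset.smul_sum]

theorem axialDirac_axialDirac {F : Sl p → A} (hF : SmoothEvenOn D F) (hDr : ReflInv p D)
    {c cb : Fin (p + 1) → A} (hc : ∀ i j, cb i * c j + cb j * c i = if i = j then 2 else 0)
    {z : Sl p} (hz : z ∈ D) :
    axialDirac cb (axialDirac c F) z = ∑ i, pdSl p i (pdSl p i F) z := by
  have h1 : axialDirac cb (axialDirac c F) z
      = ∑ i, ∑ j, cb i * c j * pdSl p i (pdSl p j F) z := by
    rw [axialDirac]
    refine Finset.sum_congr rfl fun i _ => ?_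
    rw [pdSl, (hasFDerivAt_axialDirac hD hF hDr c hz).fderiv]
    simp [pdSl, Finset.mul_sum, mul_assoc]
  have h2 : axialDirac cb (axialDirac c F) z
      = ∑ i, ∑ j, cb j * c i * pdSl p i (pdSl p j F) z := by
    rw [h1, Finset.sum_comm]
    refine Finset.sum_congr rfl fun i _ => Finset.sum_congr rfl fun j _ => ?_
    congr 1
    exact fderiv_fderiv_apply_comm hD hF.smooth hz _ _
  have h3 : (2 : ℝ) • axialDirac cb (axialDirac c F) z
      = (2 : ℝ) • ∑ i, pdSl p i (pdSl p i F) z := by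
    rw [two_smul]
    nth_rw 1 [h1]
    rw [h2, ← Finset.sum_add_distrib, Finset.smul_sum]
    refine Finset.sum_congr rfl fun i _ => ?_
    rw [← Finset.sum_add_distrib]
    simp only [← add_mul, hc, ite_mul, zero_mul, Finset.sum_ite_eq, Finset.mem_univ, if_true]
    rw [two_mul, two_smul]
  exact smul_right_injective A two_ne_zero h3

end AxialDirac

section RadialLift

variable {p q : ℕ} {F' : Type*} [NormedAddCommGroup F'] [NormedSpace ℝ F']

/-- The function `𝐱 ↦ F(𝐱_p, |𝐱_q|)` on `ℝ^{p+q+1}`. -/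
def radialLift (q : ℕ) (F : Sl p → F') : V p q → F' := fun x => F (x.1, ‖x.2‖)

theorem hasFDerivAt_radialLift {F H : Sl p → F'} {x : V p q}
    (hF : DifferentiableAt ℝ F (x.1, ‖x.2‖))
    (hH : pdr p F (x.1, ‖x.2‖) = ‖x.2‖ • H (x.1, ‖x.2‖)) :
    HasFDerivAt (radialLift q F)
      ((fderiv ℝ F (x.1, ‖x.2‖)).comp
          ((ContinuousLinearMap.fst ℝ (Vp p) (Vq q)).prod (0 : V p q →L[ℝ] ℝ)) +
        ((innerSL ℝ x.2).comp (ContinuousLinearMap.snd ℝ (Vp p) (Vq q))).smulRight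
          (H (x.1, ‖x.2‖))) x := by
  have hsplit (a : Vp p) (t : ℝ) : fderiv ℝ F (x.1, ‖x.2‖) (a, t)
      = fderiv ℝ F (x.1, ‖x.2‖) (a, 0) + t • ‖x.2‖ • H (x.1, ‖x.2‖) := by
    rw [← hH, pdr, ← map_smul, ← map_add]
    simp
  by_cases hx : x.2 = 0
  · have hcont : Tendsto (fun y : V p q => ((y.1, ‖y.2‖) : Sl p)) (𝓝 x) (𝓝 (x.1, ‖x.2‖)) :=
      (by fun_prop : Continuous fun y : V p q => ((y.1, ‖y.2‖) : Sl p)).tendsto x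
    have h := (hF.hasFDerivAt.isLittleO.comp_tendsto hcont)
    refine HasFDerivAt.of_isLittleO ?_
    have h2 : (fun y : V p q => ((y.1, ‖y.2‖) : Sl p) - (x.1, ‖x.2‖)) =O[𝓝 x] fun y => y - x := by
      refine Asymptotics.IsBigO.of_bound 1 (Eventually.of_forall fun y => ?_)
      simp [Prod.norm_def, hx]
    refine (h.trans_isBigO h2).congr_left fun y => ?_
    simp only [Function.comp, radialLift, Prod.mk_sub_mk]
    rw [hsplit]
    simp [hx]
  · have hn : HasFDerivAt (fun y : Vq q => ‖y‖) (‖x.2‖⁻¹ • innerSL ℝ x.2) x.2 := by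
      have h1 := ((hasStrictFDerivAt_norm_sq x.2).hasFDerivAt).sqrt (by simpa using hx)
      simp only [Real.sqrt_sq (norm_nonneg _)] at h1
      refine h1.congr_fderiv ?_
      ext v
      simp
      field_simp
    have h1 : HasFDerivAt (fun y : V p q => ((y.1, ‖y.2‖) : Sl p)) _ x :=
      hasFDerivAt_fst.prodMk (hn.comp x hasFDerivAt_snd)
    refine (hF.hasFDerivAt.comp x h1).congr_fderiv ?_
    refine ContinuousLinearMap.ext fun v => ?_
    have hx' : ‖x.2‖ ≠ 0 := norm_ne_zero_iff.2 hx
    simp only [ContinuousLinearMap.comp_apply, ContinuousLinearMap.prod_apply]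
    rw [hsplit]
    simp [smul_smul]
    field_simp

variable {D : Set (Sl p)} {Ω : Set (V p q)} (hD : IsOpen D) (hΩ : IsOpen Ω)
  (hΩD : ∀ x ∈ Ω, ((x.1, ‖x.2‖) : Sl p) ∈ D)

include hD hΩD

theorem SmoothEvenOn.hasFDerivAt_radialLift {F H : Sl p → F'} (hF : SmoothEvenOn D F)
    (h : IsRadDerivOn D F H) {x : V p q} (hx : x ∈ Ω) :
    HasFDerivAt (radialLift q F)
      ((fderiv ℝ F (x.1, ‖x.2‖)).comp
          ((ContinuousLinearMap.fst ℝ (Vp p) (Vq q)).prod (0 : V p q →L[ℝ] ℝ)) +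
        ((innerSL ℝ x.2).comp (ContinuousLinearMap.snd ℝ (Vp p) (Vq q))).smulRight
          (H (x.1, ‖x.2‖))) x :=
  _root_.hasFDerivAt_radialLift (hF.differentiableAt hD (hΩD x hx)) (h _ (hΩD x hx))

theorem pdV1_radialLift {F H : Sl p → F'} (hF : SmoothEvenOn D F)
    (h : IsRadDerivOn D F H) {x : V p q} (hx : x ∈ Ω) (i : Fin (p + 1)) :
    pdV1 p q i (radialLift q F) x = radialLift q (pdSl p i F) x := by
  rw [pdV1, (hF.hasFDerivAt_radialLift hD hΩD h hx).fderiv]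
  simp [radialLift, pdSl]

theorem pdV2_radialLift {F H : Sl p → F'} (hF : SmoothEvenOn D F)
    (h : IsRadDerivOn D F H) {x : V p q} (hx : x ∈ Ω) (j : Fin q) :
    pdV2 p q j (radialLift q F) x = x.2 j • radialLift q H x := by
  rw [pdV2, (hF.hasFDerivAt_radialLift hD hΩD h hx).fderiv]
  simp [radialLift, ← Prod.zero_eq_mk, EuclideanSpace.inner_single_right]

include hΩ

theorem SmoothEvenOn.contDiffOn_radialLift [CompleteSpace F'] {F : Sl p → F'}
    (hF : SmoothEvenOn D F) (hDr : ReflInv p D) :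
    ContDiffOn ℝ (⊤ : ℕ∞) (radialLift q F) Ω := by
  rw [contDiffOn_infty]
  intro n
  induction n generalizing F with
  | zero =>
    rw [Nat.cast_zero, contDiffOn_zero]
    exact hF.smooth.continuousOn.comp (by fun_prop) hΩD
  | succ n ih =>
    obtain ⟨H, hH, h⟩ := hF.exists_radDeriv hD hDr
    rw [Nat.cast_succ, contDiffOn_succ_iff_fderiv_of_isOpen hΩ]
    refine ⟨fun x hx => (hF.hasFDerivAt_radialLift hD hΩD h hx).differentiableAt.differentiableWithinAt,
      fun h => by simp at h, ?_⟩
    rw [contDiffOn_clm_apply]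
    intro v
    have h1 : SmoothEvenOn D fun z => fderiv ℝ F z (v.1, 0) :=
      ⟨hF.smooth.fderiv_apply_const hD _, fun z hz => by
        have := hF.fderiv_reflection hD hDr hz v.1 0
        rwa [neg_zero] at this⟩
    have h2 : ContDiffOn ℝ n (fun x : V p q => ⟪x.2, v.2⟫ • radialLift q H x) Ω :=
      (contDiffOn_snd.inner ℝ contDiffOn_const).smul (ih hH)
    refine ((ih h1).add h2).congr fun x hx => ?_
    rw [(hF.hasFDerivAt_radialLift hD hΩD h hx).fderiv]
    simp [radialLift]

end RadialLift

section CliffordRelations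

variable {p q : ℕ} {A : Type*} [NormedRing A] [NormedAlgebra ℝ A] (ξ : A ≃ₐ[ℝ] Cl (p + q))

theorem gen_mul_gen_add (i j : Fin (p + q)) :
    gen p q ξ i * gen p q ξ j + gen p q ξ j * gen p q ξ i = if i = j then -2 else 0 := by
  rw [gen, gen, ← map_mul, ← map_mul, ← map_add, e, e, CliffordAlgebra.ι_mul_ι_add_swap,
    AlgEquiv.commutes]
  have h : QuadraticMap.polar (Qe (p + q)) (Pi.single i 1) (Pi.single j 1)
      = if i = j then -2 else 0 := by
    simp only [QuadraticMap.polar, Qe, QuadraticMap.weightedSumSquares_apply, Pi.add_apply,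
      smul_eq_mul, ← Finset.sum_sub_distrib]
    have (k : Fin (p + q)) : -1 * (((Pi.single i 1 : Fin (p + q) → ℝ) k +
        (Pi.single j 1 : Fin (p + q) → ℝ) k) * ((Pi.single i 1 : Fin (p + q) → ℝ) k +
        (Pi.single j 1 : Fin (p + q) → ℝ) k)) - -1 * ((Pi.single i 1 : Fin (p + q) → ℝ) k *
        (Pi.single i 1 : Fin (p + q) → ℝ) k) - -1 * ((Pi.single j 1 : Fin (p + q) → ℝ) k *
        (Pi.single j 1 : Fin (p + q) → ℝ) k)
        = -2 * (Pi.single i 1 : Fin (p + q) → ℝ) k * (Pi.single j 1 : Fin (p + q) → ℝ) k := by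
      ring
    simp only [this]
    simp [Pi.single_apply, eq_comm]
  rw [h]
  split_ifs
  · simpa using map_ofNat (algebraMap ℝ A) 2
  · simp

theorem gen_mul_gen_of_ne {i j : Fin (p + q)} (h : i ≠ j) :
    gen p q ξ i * gen p q ξ j = - (gen p q ξ j * gen p q ξ i) := by
  have := gen_mul_gen_add ξ i j
  rw [if_neg h] at this
  exact eq_neg_of_add_eq_zero_left this

theorem eQ_mul_eQ_add (i j : Fin q) :
    eQ p q ξ i * eQ p q ξ j + eQ p q ξ j * eQ p q ξ i = if i = j then -2 else 0 := by
  rw [eQ, eQ, gen_mul_gen_add]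
  simp [Fin.ext_iff]

theorem eQ_mul_self (i : Fin q) : eQ p q ξ i * eQ p q ξ i = -1 := by
  have h := eQ_mul_eQ_add ξ i i
  rw [if_pos rfl, ← two_smul ℝ, show (-2 : A) = (2 : ℝ) • (-1 : A) by rw [two_smul]; norm_num] at h
  exact smul_right_injective A two_ne_zero h

/-- The conjugates `1, -e_1, …, -e_p` of the paravector basis. -/
def εpBar (p q : ℕ) (ξ : A ≃ₐ[ℝ] Cl (p + q)) (i : Fin (p + 1)) : A :=
  if h : (i : ℕ) = 0 then 1 else - gen p q ξ ⟨(i : ℕ) - 1, by have := i.isLt; omega⟩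

theorem εpBar_mul_εp_add (i j : Fin (p + 1)) :
    εpBar p q ξ i * εp p q ξ j + εpBar p q ξ j * εp p q ξ i = if i = j then 2 else 0 := by
  unfold εpBar εp
  by_cases hi : (i : ℕ) = 0 <;> by_cases hj : (j : ℕ) = 0
  · rw [if_pos (Fin.ext (hi.trans hj.symm))]
    simp [hi, hj, one_add_one_eq_two]
  · rw [if_neg (fun h : i = j => hj (h ▸ hi))]
    simp [hi, hj]
  · rw [if_neg (fun h : i = j => hi (h ▸ hj))]
    simp [hi, hj]
  · simp only [hi, hj, dif_neg, not_false_eq_true, neg_mul, ← neg_add, gen_mul_gen_add]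
    have : (i : ℕ) - 1 = j - 1 ↔ i = j := by rw [Fin.ext_iff]; omega
    simp only [Fin.mk.injEq, this]
    split_ifs <;> simp

theorem εp_mul_εpBar_add (i j : Fin (p + 1)) :
    εp p q ξ i * εpBar p q ξ j + εp p q ξ j * εpBar p q ξ i = if i = j then 2 else 0 := by
  unfold εpBar εp
  by_cases hi : (i : ℕ) = 0 <;> by_cases hj : (j : ℕ) = 0
  · rw [if_pos (Fin.ext (hi.trans hj.symm))]
    simp [hi, hj, one_add_one_eq_two]
  · rw [if_neg (fun h : i = j => hj (h ▸ hi))]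
    simp [hi, hj]
  · rw [if_neg (fun h : i = j => hi (h ▸ hj))]
    simp [hi, hj]
  · simp only [hi, hj, dif_neg, not_false_eq_true, mul_neg, ← neg_add, gen_mul_gen_add]
    have : (i : ℕ) - 1 = j - 1 ↔ i = j := by rw [Fin.ext_iff]; omega
    simp only [Fin.mk.injEq, this]
    split_ifs <;> simp

theorem εp_mul_eQ (i : Fin (p + 1)) (j : Fin q) :
    εp p q ξ i * eQ p q ξ j = eQ p q ξ j * εpBar p q ξ i := by
  unfold εpBar εp
  by_cases hi : (i : ℕ) = 0
  · simp [hi]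
  · simp only [hi, dif_neg, not_false_eq_true, mul_neg]
    rw [eQ, gen_mul_gen_of_ne]
    rw [Ne, Fin.ext_iff]
    have := i.isLt
    simp only
    omega

theorem εp_mul_ωCl (i : Fin (p + 1)) (v : Vq q) :
    εp p q ξ i * ωCl p q ξ v = ωCl p q ξ v * εpBar p q ξ i := by
  simp only [ωCl, Finset.mul_sum, Finset.sum_mul, mul_smul_comm, smul_mul_assoc, εp_mul_eQ]

theorem ωCl_smul (t : ℝ) (v : Vq q) : ωCl p q ξ (t • v) = t • ωCl p q ξ v := by
  simp [ωCl, Finset.smul_sum, mul_smul]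

theorem ωCl_neg (v : Vq q) : ωCl p q ξ (-v) = - ωCl p q ξ v := by
  simp [ωCl]

theorem ωCl_single (j : Fin q) : ωCl p q ξ (EuclideanSpace.single j 1) = eQ p q ξ j := by
  simp [ωCl, ite_smul]

theorem eQ_mul_ωCl_add (j : Fin q) (v : Vq q) :
    eQ p q ξ j * ωCl p q ξ v + ωCl p q ξ v * eQ p q ξ j = (-2 * v j) • (1 : A) := by
  simp only [ωCl, Finset.mul_sum, Finset.sum_mul, mul_smul_comm, smul_mul_assoc,
    ← Finset.sum_add_distrib, ← smul_add, eQ_mul_eQ_add, smul_ite, smul_zero,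
    Finset.sum_ite_eq, Finset.mem_univ, if_true]
  rw [mul_comm, mul_smul]
  congr 1
  rw [neg_smul, two_smul, one_add_one_eq_two]

theorem ωCl_mul_self (v : Vq q) : ωCl p q ξ v * ωCl p q ξ v = -(‖v‖ ^ 2 • (1 : A)) := by
  have h : (2 : ℝ) • (ωCl p q ξ v * ωCl p q ξ v) = (2 : ℝ) • -(‖v‖ ^ 2 • (1 : A)) := by
    have h1 : (2 : ℝ) • (ωCl p q ξ v * ωCl p q ξ v)
        = ∑ j, v j • (eQ p q ξ j * ωCl p q ξ v + ωCl p q ξ v * eQ p q ξ j) := by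
      simp only [smul_add, Finset.sum_add_distrib, two_smul]
      congr 1
      · conv_lhs => rw [ωCl, Finset.sum_mul]
        simp only [smul_mul_assoc]
        rfl
      · conv_lhs => enter [2]; rw [ωCl]
        rw [Finset.mul_sum]
        simp only [mul_smul_comm]
    rw [h1, EuclideanSpace.norm_sq_eq]
    simp only [eQ_mul_ωCl_add, smul_smul, ← Finset.sum_smul, ← neg_smul, Real.norm_eq_abs, sq_abs]
    congr 1
    rw [mul_neg, Finset.mul_sum, ← Finset.sum_neg_distrib]
    exact Finset.sum_congr rfl fun j _ => by ring
  exact smul_right_injective A two_ne_zero h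

end CliffordRelations

section RadialSequences

variable {p q : ℕ} {F' : Type*} [NormedAddCommGroup F'] [NormedSpace ℝ F'] {D : Set (Sl p)}

/-- A sequence of smooth even functions with `Φ_{k+1} = (1/r) ∂_r Φ_k`. -/
structure IsRadSeqOn (D : Set (Sl p)) (Φ : ℕ → Sl p → F') : Prop where
  smoothEven : ∀ k, SmoothEvenOn D (Φ k)
  radDeriv : ∀ k, IsRadDerivOn D (Φ k) (Φ (k + 1))

theorem SmoothEvenOn.exists_isRadSeqOn [CompleteSpace F'] (hD : IsOpen D) (hDr : ReflInv p D)
    {F : Sl p → F'} (hF : SmoothEvenOn D F) : ∃ Φ, IsRadSeqOn D Φ ∧ Φ 0 = F := by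
  choose R hR using fun G : {G : Sl p → F' // SmoothEvenOn D G} => G.2.exists_radDeriv hD hDr
  let Φ : ℕ → {G : Sl p → F' // SmoothEvenOn D G} :=
    fun k => Nat.rec ⟨F, hF⟩ (fun _ G => ⟨R G, (hR G).1⟩) k
  exact ⟨fun k => (Φ k).1, ⟨fun k => (Φ k).2, fun k => (hR (Φ k)).2⟩, rfl⟩

theorem IsRadSeqOn.pdSl (hD : IsOpen D) (hDr : ReflInv p D) {Φ : ℕ → Sl p → F'}
    (h : IsRadSeqOn D Φ) (i : Fin (p + 1)) : IsRadSeqOn D fun k => pdSl p i (Φ k) :=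
  ⟨fun k => (h.smoothEven k).pdSl hD hDr i,
    fun k => (h.radDeriv k).pdSl hD (h.smoothEven k) (h.smoothEven (k + 1)) i⟩

end RadialSequences

section CliffordLift

variable {p q : ℕ} {A : Type*} [NormedRing A] [NormedAlgebra ℝ A] (ξ : A ≃ₐ[ℝ] Cl (p + q))

/-- The function `𝐱 ↦ Φ(𝐱_p, |𝐱_q|) + 𝐱_q Γ(𝐱_p, |𝐱_q|)` on `ℝ^{p+q+1}`. -/
def cliffordLift (Φ Γ : Sl p → A) : V p q → A :=
  fun x => radialLift q Φ x + ωCl p q ξ x.2 * radialLift q Γ x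

/-- `ωCl` as a continuous linear map. -/
def ωClL : Vq q →L[ℝ] A :=
  ∑ j, (EuclideanSpace.proj j : Vq q →L[ℝ] ℝ).smulRight (eQ p q ξ j)

theorem ωClL_apply (v : Vq q) : ωClL ξ v = ωCl p q ξ v := by
  simp [ωClL, ωCl]

theorem hasFDerivAt_ωCl_snd (x : V p q) :
    HasFDerivAt (fun x : V p q => ωCl p q ξ x.2)
      ((ωClL ξ).comp (ContinuousLinearMap.snd ℝ (Vp p) (Vq q))) x := by
  simp only [← ωClL_apply]
  exact ((ωClL ξ).comp (ContinuousLinearMap.snd ℝ (Vp p) (Vq q))).hasFDerivAt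

theorem contDiff_ωCl_snd {n : WithTop ℕ∞} : ContDiff ℝ n fun x : V p q => ωCl p q ξ x.2 := by
  simp only [← ωClL_apply]
  exact ((ωClL ξ).comp (ContinuousLinearMap.snd ℝ (Vp p) (Vq q))).contDiff

variable {D : Set (Sl p)} {Ω : Set (V p q)} (hD : IsOpen D) (hDr : ReflInv p D) (hΩ : IsOpen Ω)
  (hΩD : ∀ x ∈ Ω, ((x.1, ‖x.2‖) : Sl p) ∈ D) {Φ Γ : ℕ → Sl p → A} (hΦ : IsRadSeqOn D Φ)
  (hΓ : IsRadSeqOn D Γ)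

include hD hDr hΩ hΩD in
theorem contDiffOn_cliffordLift [CompleteSpace A] {F G : Sl p → A} (hF : SmoothEvenOn D F)
    (hG : SmoothEvenOn D G) : ContDiffOn ℝ (⊤ : ℕ∞) (cliffordLift ξ F G) Ω :=
  (hF.contDiffOn_radialLift hD hΩ hΩD hDr).add
    ((contDiff_ωCl_snd ξ).contDiffOn.mul (hG.contDiffOn_radialLift hD hΩ hΩD hDr))

include hD hΩD hΦ hΓ

theorem fderiv_cliffordLift (k : ℕ) {x : V p q} (hx : x ∈ Ω) (v : V p q) :
    fderiv ℝ (cliffordLift ξ (Φ k) (Γ k)) x v = fderiv ℝ (radialLift q (Φ k)) x v +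
      (ωCl p q ξ x.2 * fderiv ℝ (radialLift q (Γ k)) x v +
        ωCl p q ξ v.2 * radialLift q (Γ k) x) := by
  have h1 := ((hΦ.smoothEven k).hasFDerivAt_radialLift hD hΩD
    (hΦ.radDeriv k) hx).differentiableAt.hasFDerivAt
  have h2 := ((hΓ.smoothEven k).hasFDerivAt_radialLift hD hΩD
    (hΓ.radDeriv k) hx).differentiableAt.hasFDerivAt
  have h3 : HasFDerivAt (cliffordLift ξ (Φ k) (Γ k)) _ x :=
    h1.add ((hasFDerivAt_ωCl_snd ξ x).mul' h2)
  rw [h3.fderiv]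
  simp [ωClL_apply]

theorem pdV1_cliffordLift (k : ℕ) {x : V p q} (hx : x ∈ Ω) (i : Fin (p + 1)) :
    pdV1 p q i (cliffordLift ξ (Φ k) (Γ k)) x
      = cliffordLift ξ (pdSl p i (Φ k)) (pdSl p i (Γ k)) x := by
  rw [pdV1, fderiv_cliffordLift ξ hD hΩD hΦ hΓ k hx, cliffordLift,
    ← pdV1_radialLift hD hΩD (hΦ.smoothEven k) (hΦ.radDeriv k) hx,
    ← pdV1_radialLift hD hΩD (hΓ.smoothEven k) (hΓ.radDeriv k) hx]
  simp [pdV1, ωCl]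

theorem pdV2_cliffordLift (k : ℕ) {x : V p q} (hx : x ∈ Ω) (j : Fin q) :
    pdV2 p q j (cliffordLift ξ (Φ k) (Γ k)) x
      = x.2 j • cliffordLift ξ (Φ (k + 1)) (Γ (k + 1)) x + eQ p q ξ j * radialLift q (Γ k) x := by
  have h1 := pdV2_radialLift hD hΩD (hΦ.smoothEven k) (hΦ.radDeriv k) hx j
  have h2 := pdV2_radialLift hD hΩD (hΓ.smoothEven k) (hΓ.radDeriv k) hx j
  rw [pdV2] at h1 h2
  rw [pdV2, fderiv_cliffordLift ξ hD hΩD hΦ hΓ k hx, h1, h2, ωCl_single, cliffordLift]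
  simp [smul_add, add_assoc]

include hDr hΩ

theorem lapV_cliffordLift (k : ℕ) {x : V p q} (hx : x ∈ Ω) :
    LapV p q (cliffordLift ξ (Φ k) (Γ k)) x
      = cliffordLift ξ (fun z => ∑ i, pdSl p i (pdSl p i (Φ k)) z)
          (fun z => ∑ i, pdSl p i (pdSl p i (Γ k)) z) x
        + (q : ℝ) • cliffordLift ξ (Φ (k + 1)) (Γ (k + 1)) x
        + ‖x.2‖ ^ 2 • cliffordLift ξ (Φ (k + 2)) (Γ (k + 2)) x
        + (2 : ℝ) • (ωCl p q ξ x.2 * radialLift q (Γ (k + 1)) x) := by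
  have hV1 (i) : pdV1 p q i (pdV1 p q i (cliffordLift ξ (Φ k) (Γ k))) x
      = cliffordLift ξ (pdSl p i (pdSl p i (Φ k))) (pdSl p i (pdSl p i (Γ k))) x := by
    have : pdV1 p q i (cliffordLift ξ (Φ k) (Γ k)) =ᶠ[𝓝 x]
        cliffordLift ξ (pdSl p i (Φ k)) (pdSl p i (Γ k)) := by
      filter_upwards [hΩ.mem_nhds hx] with y hy
      exact pdV1_cliffordLift ξ hD hΩD hΦ hΓ k hy i
    rw [pdV1, this.fderiv_eq]
    exact pdV1_cliffordLift ξ hD hΩD (hΦ.pdSl hD hDr i) (hΓ.pdSl hD hDr i) k hx i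
  have hV2 (j) : pdV2 p q j (pdV2 p q j (cliffordLift ξ (Φ k) (Γ k))) x
      = cliffordLift ξ (Φ (k + 1)) (Γ (k + 1)) x
        + (x.2 j) ^ 2 • cliffordLift ξ (Φ (k + 2)) (Γ (k + 2)) x
        + (2 : ℝ) • (x.2 j • eQ p q ξ j * radialLift q (Γ (k + 1)) x) := by
    have h0 : pdV2 p q j (cliffordLift ξ (Φ k) (Γ k)) =ᶠ[𝓝 x] fun x =>
        x.2 j • cliffordLift ξ (Φ (k + 1)) (Γ (k + 1)) x + eQ p q ξ j * radialLift q (Γ k) x := by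
      filter_upwards [hΩ.mem_nhds hx] with y hy
      exact pdV2_cliffordLift ξ hD hΩD hΦ hΓ k hy j
    have h1 : HasFDerivAt (fun x : V p q => x.2 j)
        ((EuclideanSpace.proj j : Vq q →L[ℝ] ℝ).comp
          (ContinuousLinearMap.snd ℝ (Vp p) (Vq q))) x :=
      ((EuclideanSpace.proj j : Vq q →L[ℝ] ℝ).comp
          (ContinuousLinearMap.snd ℝ (Vp p) (Vq q))).hasFDerivAt
    have h2 : DifferentiableAt ℝ (cliffordLift ξ (Φ (k + 1)) (Γ (k + 1))) x :=
      ((hΦ.smoothEven (k + 1)).hasFDerivAt_radialLift hD hΩD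
        (hΦ.radDeriv (k + 1)) hx).differentiableAt.add
        ((hasFDerivAt_ωCl_snd ξ x).differentiableAt.mul
          ((hΓ.smoothEven (k + 1)).hasFDerivAt_radialLift hD hΩD
            (hΓ.radDeriv (k + 1)) hx).differentiableAt)
    have h3 : DifferentiableAt ℝ (radialLift q (Γ k)) x :=
      ((hΓ.smoothEven k).hasFDerivAt_radialLift hD hΩD (hΓ.radDeriv k) hx).differentiableAt
    have h4 : HasFDerivAt (fun x : V p q => x.2 j • cliffordLift ξ (Φ (k + 1)) (Γ (k + 1)) x
        + eQ p q ξ j * radialLift q (Γ k) x) _ x :=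
      (h1.smul h2.hasFDerivAt).add (h3.hasFDerivAt.const_mul (eQ p q ξ j))
    have e1 := pdV2_cliffordLift ξ hD hΩD hΦ hΓ (k + 1) hx j
    have e2 := pdV2_radialLift hD hΩD (hΓ.smoothEven k) (hΓ.radDeriv k) hx j
    rw [pdV2] at e1 e2
    rw [pdV2, h0.fderiv_eq, h4.fderiv]
    have e3 : (EuclideanSpace.proj j : Vq q →L[ℝ] ℝ) (EuclideanSpace.single j 1) = 1 := by simp
    simp only [add_apply, smul_apply, ContinuousLinearMap.smulRight_apply,
      ContinuousLinearMap.comp_apply, e1, e2, ContinuousLinearMap.coe_snd', e3, one_smul,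
      smul_eq_mul, mul_smul_comm, smul_mul_assoc, smul_add, smul_smul, sq]
    rw [two_mul, add_smul]
    abel
  rw [LapV]
  simp only [hV1, hV2, Finset.sum_add_distrib, Finset.sum_const, ← Finset.sum_smul,
    ← Finset.smul_sum, ← Finset.sum_mul, Finset.card_univ, Fintype.card_fin]
  rw [EuclideanSpace.norm_sq_eq]
  simp only [Real.norm_eq_abs, sq_abs, ← Nat.cast_smul_eq_nsmul ℝ]
  simp only [cliffordLift, Finset.sum_add_distrib, radialLift, Finset.mul_sum]
  rw [ωCl]
  abel

omit hDr hΩ in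
theorem dV_cliffordLift (k : ℕ) {x : V p q} (hx : x ∈ Ω) :
    DV p q ξ (cliffordLift ξ (Φ k) (Γ k)) x
      = axialDirac (εp p q ξ) (Φ k) (x.1, ‖x.2‖)
        + ωCl p q ξ x.2 * axialDirac (εpBar p q ξ) (Γ k) (x.1, ‖x.2‖)
        + ωCl p q ξ x.2 * Φ (k + 1) (x.1, ‖x.2‖)
        - ‖x.2‖ ^ 2 • Γ (k + 1) (x.1, ‖x.2‖) - (q : ℝ) • Γ k (x.1, ‖x.2‖) := by
  have h1 : ∑ i, εp p q ξ i * pdV1 p q i (cliffordLift ξ (Φ k) (Γ k)) x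
      = axialDirac (εp p q ξ) (Φ k) (x.1, ‖x.2‖)
        + ωCl p q ξ x.2 * axialDirac (εpBar p q ξ) (Γ k) (x.1, ‖x.2‖) := by
    simp only [pdV1_cliffordLift ξ hD hΩD hΦ hΓ k hx, axialDirac, Finset.mul_sum,
      ← Finset.sum_add_distrib]
    refine Finset.sum_congr rfl fun i _ => ?_
    rw [cliffordLift, mul_add, ← mul_assoc, εp_mul_ωCl, mul_assoc]
    rfl
  have h2 : ∑ j, eQ p q ξ j * pdV2 p q j (cliffordLift ξ (Φ k) (Γ k)) x
      = ωCl p q ξ x.2 * cliffordLift ξ (Φ (k + 1)) (Γ (k + 1)) x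
        - (q : ℝ) • Γ k (x.1, ‖x.2‖) := by
    simp only [pdV2_cliffordLift ξ hD hΩD hΦ hΓ k hx, mul_add, Finset.sum_add_distrib,
      ← mul_assoc, eQ_mul_self, ← Finset.sum_mul]
    rw [sub_eq_add_neg]
    congr 1
    · rw [ωCl, Finset.sum_mul]
      exact Finset.sum_congr rfl fun j _ => by rw [mul_smul_comm, smul_mul_assoc]
    · simp [radialLift, Nat.cast_smul_eq_nsmul]
  rw [DV, h1, h2, cliffordLift, mul_add, ← mul_assoc, ωCl_mul_self]
  simp only [radialLift, neg_mul, smul_mul_assoc, one_mul]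
  abel

end CliffordLift

section FueterSce

variable {p q : ℕ} {A : Type*} [NormedRing A] [NormedAlgebra ℝ A]

theorem Set.EqOn.lapV {f g : V p q → A} {Ω : Set (V p q)} (hΩ : IsOpen Ω) (h : Set.EqOn f g Ω) :
    Set.EqOn (LapV p q f) (LapV p q g) Ω := by
  have key {f g : V p q → A} (h : Set.EqOn f g Ω) (v : V p q) :
      Set.EqOn (fun x => fderiv ℝ f x v) (fun x => fderiv ℝ g x v) Ω := fun x hx => by
    simp only [(h.eventuallyEq_of_mem (hΩ.mem_nhds hx)).fderiv_eq]
  intro x hx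
  rw [LapV, LapV]
  congr 1 <;> refine Finset.sum_congr rfl fun i _ => ?_
  · exact key (key h _) _ hx
  · exact key (key h _) _ hx

theorem lapV_const_smul (c : ℝ) (f : V p q → A) : LapV p q (c • f) = c • LapV p q f := by
  have key (f : V p q → A) (v : V p q) :
      (fun x => fderiv ℝ (c • f) x v) = c • fun x => fderiv ℝ f x v := by
    ext x
    rw [fderiv_const_smul_field]
    rfl
  ext x
  simp only [LapV, Pi.smul_apply, smul_add, Finset.smul_sum]
  congr 1 <;> refine Finset.sum_congr rfl fun i _ => ?_
  · have : pdV1 p q i (c • f) = c • pdV1 p q i f := key _ _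
    rw [this]
    exact congrFun (key _ _) x
  · have : pdV2 p q i (c • f) = c • pdV2 p q i f := key _ _
    rw [this]
    exact congrFun (key _ _) x

variable (ξ : A ≃ₐ[ℝ] Cl (p + q)) {D : Set (Sl p)} {Ω : Set (V p q)} (hD : IsOpen D)
  (hDr : ReflInv p D) (hΩ : IsOpen Ω) (hΩD : ∀ x ∈ Ω, ((x.1, ‖x.2‖) : Sl p) ∈ D)
  {Φ Γ : ℕ → Sl p → A} (hΦ : IsRadSeqOn D Φ) (hΓ : IsRadSeqOn D Γ)
  (hCR : ∀ z ∈ D, axialDirac (εp p q ξ) (Φ 0) z = Γ 0 z + z.2 ^ 2 • Γ 1 z ∧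
    Φ 1 z = - axialDirac (εpBar p q ξ) (Γ 0) z)

include hD hDr hΦ hΓ hCR

/-- The Cauchy–Riemann system satisfied by the iterated radial derivatives. -/
theorem cauchyRiemann_radSeq (k : ℕ) :
    Set.EqOn (axialDirac (εp p q ξ) (Φ k))
      (fun z => (2 * k + 1 : ℝ) • Γ k z + z.2 ^ 2 • Γ (k + 1) z) D ∧
    Set.EqOn (Φ (k + 1)) (fun z => - axialDirac (εpBar p q ξ) (Γ k) z) D := by
  induction k with
  | zero => exact ⟨fun z hz => by simpa using (hCR z hz).1, fun z hz => (hCR z hz).2⟩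
  | succ k ih =>
    constructor
    · have h := ((hΦ.radDeriv k).axialDirac hD hDr (hΦ.smoothEven k) (hΦ.smoothEven (k + 1))
        (εp p q ξ)).unique hD ((hΓ.radDeriv k).smul_add_sq_smul hD (hΓ.radDeriv (k + 1))
          (hΓ.smoothEven k) (hΓ.smoothEven (k + 1)) (2 * k + 1)) ih.1
        ((hΦ.smoothEven (k + 1)).axialDirac hD hDr _)
        ((hΓ.smoothEven (k + 1)).smul_add_sq_smul (hΓ.smoothEven (k + 2)) _)
      intro z hz
      rw [h hz]
      push_cast
      ring_nf
    · exact (hΦ.radDeriv (k + 1)).unique hD ((hΓ.radDeriv k).axialDirac hD hDr (hΓ.smoothEven k)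
        (hΓ.smoothEven (k + 1)) (εpBar p q ξ)).neg ih.2 (hΦ.smoothEven (k + 2))
        ((hΓ.smoothEven (k + 1)).axialDirac hD hDr _).neg

theorem lap_radSeq_even (k : ℕ) {z : Sl p} (hz : z ∈ D) :
    ∑ i, pdSl p i (pdSl p i (Φ k)) z
      = -((2 * k + 1 : ℝ) • Φ (k + 1) z + z.2 ^ 2 • Φ (k + 2) z) := by
  have h := cauchyRiemann_radSeq ξ hD hDr hΦ hΓ hCR
  rw [← axialDirac_axialDirac hD (hΦ.smoothEven k) hDr (εpBar_mul_εp_add ξ) hz,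
    axialDirac_congr hD (h k).1 _ hz, axialDirac_smul_add_sq_smul hD (hΓ.smoothEven k)
      (hΓ.smoothEven (k + 1)) _ _ hz, (h k).2 hz, (h (k + 1)).2 hz]
  simp only [smul_neg]
  abel

theorem lap_radSeq_odd (k : ℕ) {z : Sl p} (hz : z ∈ D) :
    ∑ i, pdSl p i (pdSl p i (Γ k)) z
      = -((2 * k + 3 : ℝ) • Γ (k + 1) z + z.2 ^ 2 • Γ (k + 2) z) := by
  have h := cauchyRiemann_radSeq ξ hD hDr hΦ hΓ hCR
  rw [← axialDirac_axialDirac hD (hΓ.smoothEven k) hDr (εp_mul_εpBar_add ξ) hz]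
  have h1 : Set.EqOn (axialDirac (εpBar p q ξ) (Γ k)) (fun z => - Φ (k + 1) z) D :=
    fun z hz => by simp only [(h k).2 hz, neg_neg]
  rw [axialDirac_congr hD h1 _ hz, axialDirac_neg, (h (k + 1)).1 hz]
  push_cast
  ring_nf

include hΩ hΩD

theorem lapV_cliffordLift_radSeq (k : ℕ) {x : V p q} (hx : x ∈ Ω) :
    LapV p q (cliffordLift ξ (Φ k) (Γ k)) x
      = (q - 1 - 2 * k : ℝ) • cliffordLift ξ (Φ (k + 1)) (Γ (k + 1)) x := by
  rw [lapV_cliffordLift ξ hD hDr hΩ hΩD hΦ hΓ k hx]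
  simp only [cliffordLift, radialLift,
    lap_radSeq_even ξ hD hDr hΦ hΓ hCR k (hΩD x hx),
    lap_radSeq_odd ξ hD hDr hΦ hΓ hCR k (hΩD x hx), mul_neg, mul_add, mul_smul_comm]
  module

theorem iterate_lapV_cliffordLift (n : ℕ) :
    Set.EqOn ((LapV p q)^[n] (cliffordLift ξ (Φ 0) (Γ 0)))
      ((∏ j ∈ Finset.range n, (q - 1 - 2 * j : ℝ)) • cliffordLift ξ (Φ n) (Γ n)) Ω := by
  induction n with
  | zero => simp [Set.eqOn_refl]
  | succ n ih =>
    intro x hx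
    rw [Function.iterate_succ_apply', ih.lapV hΩ hx, lapV_const_smul, Pi.smul_apply,
      lapV_cliffordLift_radSeq ξ hD hDr hΩ hΩD hΦ hΓ hCR n hx, Finset.prod_range_succ, mul_smul]
    rfl

theorem tauq_eqOn_cliffordLift {N : ℕ} (hN : q = 2 * N + 1) {f : V p q → A}
    (hf : Set.EqOn f (cliffordLift ξ (Φ 0) (Γ 0)) Ω) :
    Set.EqOn (tauq p q f) (cliffordLift ξ (Φ N) (Γ N)) Ω := by
  have hf' (n : ℕ) : Set.EqOn ((LapV p q)^[n] f)
      ((LapV p q)^[n] (cliffordLift ξ (Φ 0) (Γ 0))) Ω := by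
    induction n with
    | zero => exact hf
    | succ n ih =>
      rw [Function.iterate_succ']
      exact ih.lapV hΩ
  have hN' : (q - 1) / 2 = N := by omega
  have hprod : ∏ j ∈ Finset.range N, ((q : ℝ) - 1 - 2 * j) = ((q - 1)‼ : ℕ) := by
    rw [hN, Nat.add_sub_cancel, Nat.doubleFactorial_two_mul, ← Finset.prod_range_add_one_eq_factorial,
      ← Finset.prod_range_reflect]
    push_cast
    rw [← Finset.card_range N, ← Finset.prod_const, Finset.card_range, ← Finset.prod_mul_distrib]
    refine Finset.prod_congr rfl fun j hj => ?_
    have : ((N - 1 - j : ℕ) : ℝ) + (j + 1) = N := by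
      have := Finset.mem_range.1 hj
      exact_mod_cast (by omega : N - 1 - j + (j + 1) = N)
    linarith
  intro x hx
  rw [tauq, hN', hf' N hx, iterate_lapV_cliffordLift ξ hD hDr hΩ hΩD hΦ hΓ hCR N hx, hprod,
    Pi.smul_apply, smul_smul, inv_mul_cancel₀, one_smul]
  exact_mod_cast (Nat.doubleFactorial_pos _).ne'

theorem monogenicOn_tauq [CompleteSpace A] {N : ℕ} (hN : q = 2 * N + 1) {f : V p q → A}
    (hf : Set.EqOn f (cliffordLift ξ (Φ 0) (Γ 0)) Ω) :
    MonogenicOn p q ξ Ω (tauq p q f) := by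
  have h := tauq_eqOn_cliffordLift ξ hD hDr hΩ hΩD hΦ hΓ hCR hN hf
  refine ⟨((contDiffOn_cliffordLift ξ hD hDr hΩ hΩD (hΦ.smoothEven N)
    (hΓ.smoothEven N)).of_le (by simp)).congr h, fun x hx => ?_⟩
  have h1 : DV p q ξ (tauq p q f) x = DV p q ξ (cliffordLift ξ (Φ N) (Γ N)) x := by
    simp only [DV, pdV1, pdV2, (h.eventuallyEq_of_mem (hΩ.mem_nhds hx)).fderiv_eq]
  have hCRN := cauchyRiemann_radSeq ξ hD hDr hΦ hΓ hCR N
  rw [h1, dV_cliffordLift ξ hD hΩD hΦ hΓ N hx, hCRN.1 (hΩD x hx), hCRN.2 (hΩD x hx)]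
  have hq : (q : ℝ) = 2 * N + 1 := by exact_mod_cast hN
  rw [hq, mul_neg]
  module

end FueterSce

section SliceRegularity

variable {p q : ℕ} {A : Type*} [NormedRing A] [NormedAlgebra ℝ A] (ξ : A ≃ₐ[ℝ] Cl (p + q))

theorem mem_S_iff {v : Vq q} : v ∈ S q ↔ ‖v‖ = 1 := by
  rw [← sq_eq_sq₀ (norm_nonneg v) zero_le_one, EuclideanSpace.norm_sq_eq, one_pow]
  simp [S]

theorem εpBar_mul_ωCl (i : Fin (p + 1)) (v : Vq q) :
    εpBar p q ξ i * ωCl p q ξ v = ωCl p q ξ v * εp p q ξ i := by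
  have h (j : Fin q) : εpBar p q ξ i * eQ p q ξ j = eQ p q ξ j * εp p q ξ i := by
    unfold εpBar εp
    by_cases hi : (i : ℕ) = 0
    · simp [hi]
    · simp only [hi, dif_neg, not_false_eq_true, neg_mul]
      rw [eQ, gen_mul_gen_of_ne, neg_neg]
      rw [Ne, Fin.ext_iff]
      have := i.isLt
      simp only
      omega
  simp only [ωCl, Finset.mul_sum, Finset.sum_mul, mul_smul_comm, smul_mul_assoc, h]

theorem ωCl_mul_self_of_mem_S {v : Vq q} (hv : v ∈ S q) :
    ωCl p q ξ v * ωCl p q ξ v = -1 := by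
  rw [ωCl_mul_self, mem_S_iff.1 hv]
  simp

theorem contDiffOn_of_slice_monogenic [CompleteSpace A] {D : Set (Sl p)} (hD : IsOpen D)
    {v : Vq q} (hv : v ∈ S q) {g : Sl p → A} (hg : ContDiffOn ℝ 1 g D)
    (h : ∀ z ∈ D, DP p q ξ g z + ωCl p q ξ v * pdr p g z = 0) :
    ContDiffOn ℝ (⊤ : ℕ∞) g D := by
  classical
  refine contDiffOn_of_sum_mul_fderiv_eq_zero
    ((Pi.basisFun ℝ (Fin (p + 1))).prod (Module.Basis.singleton Unit ℝ))
    (c := Sum.elim (εp p q ξ) fun _ => ωCl p q ξ v)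
    (cb := Sum.elim (εpBar p q ξ) fun _ => - ωCl p q ξ v) ?_ hD hg fun z hz => ?_
  · rintro (i | i) (j | j)
    · simp [εpBar_mul_εp_add]
    · simp [εpBar_mul_ωCl]
    · simp [εpBar_mul_ωCl]
    · simp [ωCl_mul_self_of_mem_S ξ hv, one_add_one_eq_two]
  · rw [Fintype.sum_sum_type]
    simpa [DP, pdSl, pdr] using h z hz

theorem spt_neg (v : Vq q) (z : Sl p) : spt p q (-v) z = spt p q v (z.1, -z.2) := by
  simp [spt]

theorem neg_mem_S {v : Vq q} (hv : v ∈ S q) : -v ∈ S q := by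
  rw [mem_S_iff] at hv ⊢
  rwa [norm_neg]

theorem GPS.IsPSymmetric.sliceSet_subset {Ω : Set (V p q)} (h : IsPSymmetric p q Ω) {v w : Vq q}
    (hv : v ∈ S q) (hw : w ∈ S q) : sliceSet p q Ω v ⊆ sliceSet p q Ω w :=
  fun z hz => h z.1 z.2 v hv w hw hz

theorem GPS.IsPSymmetric.reflInv_sliceSet {Ω : Set (V p q)} (h : IsPSymmetric p q Ω) {v : Vq q}
    (hv : v ∈ S q) : ReflInv p (sliceSet p q Ω v) := fun z hz => by
  have := h.sliceSet_subset hv (neg_mem_S hv) hz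
  rwa [sliceSet, Set.mem_ofPred_eq, spt_neg] at this

theorem exists_eq_spt {v : Vq q} (hv : v ∈ S q) (x : V p q) :
    ∃ w ∈ S q, x = spt p q w (x.1, ‖x.2‖) := by
  by_cases hx : x.2 = 0
  · exact ⟨v, hv, Prod.ext rfl (by simp [spt, hx])⟩
  · have hx' : ‖x.2‖ ≠ 0 := norm_ne_zero_iff.2 hx
    refine ⟨‖x.2‖⁻¹ • x.2, mem_S_iff.2 ?_, Prod.ext rfl ?_⟩
    · rw [norm_smul, norm_inv, norm_norm, inv_mul_cancel₀ hx']
    · simp [spt, smul_smul, hx']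

theorem SmoothEvenOn.apply_abs {F' : Type*} [NormedAddCommGroup F'] [NormedSpace ℝ F']
    {D : Set (Sl p)} {F : Sl p → F'} (hF : SmoothEvenOn D F) {z : Sl p}
    (hz : z ∈ D) : F (z.1, |z.2|) = F z := by
  rcases abs_choice z.2 with h | h <;> rw [h]
  exact hF.even z hz

theorem cliffordLift_spt {D : Set (Sl p)} {F G : Sl p → A} (hF : SmoothEvenOn D F)
    (hG : SmoothEvenOn D G) {v : Vq q} (hv : v ∈ S q) {z : Sl p} (hz : z ∈ D) :
    cliffordLift ξ F G (spt p q v z) = F z + ωCl p q ξ v * (z.2 • G z) := by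
  have hn : ‖z.2 • v‖ = |z.2| := by rw [norm_smul, mem_S_iff.1 hv, mul_one, Real.norm_eq_abs]
  simp only [cliffordLift, radialLift, spt, hn, hF.apply_abs hz, hG.apply_abs hz, ωCl_smul,
    smul_mul_assoc, mul_smul_comm]

/-- The Cauchy–Riemann system for the even and odd parts of a slice function. -/
theorem cauchyRiemann_of_slice_monogenic {D : Set (Sl p)} (hD : IsOpen D) {v : Vq q}
    (hv : v ∈ S q) {g h F1 F2 : Sl p → A} (hg : DifferentiableOn ℝ g D)
    (hh : DifferentiableOn ℝ h D)
    (hg0 : ∀ z ∈ D, DP p q ξ g z + ωCl p q ξ v * pdr p g z = 0)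
    (hh0 : ∀ z ∈ D, DP p q ξ h z - ωCl p q ξ v * pdr p h z = 0)
    (hF1 : Set.EqOn F1 (fun z => (2 : ℝ)⁻¹ • (g z + h z)) D)
    (hF2 : Set.EqOn F2 (fun z => (2 : ℝ)⁻¹ • (ωCl p q ξ v * (h z - g z))) D)
    {z : Sl p} (hz : z ∈ D) :
    axialDirac (εp p q ξ) F1 z = pdr p F2 z ∧ pdr p F1 z = - axialDirac (εpBar p q ξ) F2 z := by
  have hgz := (hg.differentiableAt (hD.mem_nhds hz)).hasFDerivAt
  have hhz := (hh.differentiableAt (hD.mem_nhds hz)).hasFDerivAt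
  have h1 : HasFDerivAt F1 _ z := ((hgz.add hhz).const_smul (2 : ℝ)⁻¹).congr_of_eventuallyEq
    (hF1.eventuallyEq_of_mem (hD.mem_nhds hz))
  have h2 : HasFDerivAt F2 _ z :=
    (((hhz.sub hgz).const_mul (ωCl p q ξ v)).const_smul (2 : ℝ)⁻¹).congr_of_eventuallyEq
      (hF2.eventuallyEq_of_mem (hD.mem_nhds hz))
  have e1 := eq_neg_of_add_eq_zero_left (hg0 z hz)
  have e2 := sub_eq_zero.1 (hh0 z hz)
  have d1 : axialDirac (εp p q ξ) F1 z = (2 : ℝ)⁻¹ • (DP p q ξ g z + DP p q ξ h z) := by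
    simp [axialDirac, DP, pdSl, h1.fderiv, Finset.smul_sum, Finset.sum_add_distrib, mul_add]
  have d2 : axialDirac (εpBar p q ξ) F2 z
      = (2 : ℝ)⁻¹ • (ωCl p q ξ v * (DP p q ξ h z - DP p q ξ g z)) := by
    simp only [axialDirac, DP, pdSl, h2.fderiv, ← Finset.sum_sub_distrib, Finset.mul_sum,
      Finset.smul_sum]
    refine Finset.sum_congr rfl fun i _ => ?_
    simp only [smul_apply, sub_apply, smul_eq_mul, mul_smul_comm, ← mul_assoc, εpBar_mul_ωCl]
    simp only [mul_assoc, mul_sub]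
  have d3 : pdr p F1 z = (2 : ℝ)⁻¹ • (pdr p g z + pdr p h z) := by
    simp [pdr, h1.fderiv]
  have d4 : pdr p F2 z = (2 : ℝ)⁻¹ • (ωCl p q ξ v * (pdr p h z - pdr p g z)) := by
    simp [pdr, h2.fderiv]
  rw [d1, d2, d3, d4, e1, e2]
  constructor
  · rw [mul_sub, neg_add_eq_sub]
  · rw [sub_neg_eq_add, mul_add, ← mul_assoc, ← mul_assoc, ωCl_mul_self_of_mem_S ξ hv]
    simp only [neg_mul, one_mul, ← neg_add, smul_neg, neg_neg]
    rw [add_comm]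

end SliceRegularity

section RadialIterates

variable {p : ℕ} {A : Type*} [NormedRing A] [NormedAlgebra ℝ A] {D : Set (Sl p)} (hD : IsOpen D)

include hD

theorem isOpen_inter_ne_zero : IsOpen (D ∩ {z | z.2 ≠ 0}) :=
  hD.inter (isOpen_ne.preimage continuous_snd)

theorem aIter_eqOn {F : Sl p → A} {Φ : ℕ → Sl p → A} (hΦ : IsRadSeqOn D Φ)
    (hF : Set.EqOn F (Φ 0) D) (k : ℕ) :
    Set.EqOn (AIter p F k) (Φ k) (D ∩ {z | z.2 ≠ 0}) := by
  induction k with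
  | zero => exact hF.mono Set.inter_subset_left
  | succ k ih =>
    intro z hz
    change z.2⁻¹ • fderiv ℝ (AIter p F k) z (0, 1) = _
    have h : fderiv ℝ (Φ k) z (0, 1) = z.2 • Φ (k + 1) z := hΦ.radDeriv k z hz.1
    rw [(ih.eventuallyEq_of_mem ((isOpen_inter_ne_zero hD).mem_nhds hz)).fderiv_eq, h,
      inv_smul_smul₀ hz.2]

theorem bIter_eqOn {F : Sl p → A} {Γ : ℕ → Sl p → A} (hΓ : IsRadSeqOn D Γ)
    (hF : Set.EqOn F (fun z => z.2 • Γ 0 z) D) (k : ℕ) :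
    Set.EqOn (BIter p F k) (fun z => z.2 • Γ k z) (D ∩ {z | z.2 ≠ 0}) := by
  induction k with
  | zero => exact hF.mono Set.inter_subset_left
  | succ k ih =>
    intro z hz
    have h : (fun w : Sl p => w.2⁻¹ • BIter p F k w) =ᶠ[𝓝 z] Γ k := by
      filter_upwards [(isOpen_inter_ne_zero hD).mem_nhds hz] with w hw
      rw [ih hw, inv_smul_smul₀ hw.2]
    change fderiv ℝ (fun w : Sl p => w.2⁻¹ • BIter p F k w) z (0, 1) = _
    rw [h.fderiv_eq]
    exact hΓ.radDeriv k z hz.1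

omit [NormedAlgebra ℝ A] in
theorem tendsto_of_eqOn_inter_ne_zero {F G : Sl p → A}
    (h : Set.EqOn F G (D ∩ {z | z.2 ≠ 0})) (hG : ContinuousOn G D) {x : Vp p}
    (hx : (x, (0 : ℝ)) ∈ D) : Tendsto (fun t : ℝ => F (x, t)) (𝓝[≠] 0) (𝓝 (G (x, 0))) := by
  have hc : Tendsto (fun t : ℝ => ((x, t) : Sl p)) (𝓝[≠] 0) (𝓝 (x, 0)) :=
    ((by fun_prop : Continuous fun t : ℝ => ((x, t) : Sl p)).tendsto 0).mono_left
      nhdsWithin_le_nhds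
  refine ((hG.continuousAt (hD.mem_nhds hx)).tendsto.comp hc).congr' ?_
  filter_upwards [hc.eventually (hD.mem_nhds hx), self_mem_nhdsWithin] with t ht ht0
  exact (h ⟨ht, ht0⟩).symm

end RadialIterates

/-- Theorem 3.12.  Let `Ω` be a p-symmetric slice domain and `f ∈ 𝒢𝒮ℳ(Ω)`, written
`f = F₁ + ωF₂` via the Representation Formula.  Then for odd `q`,
`τ_q f = (1/(q−1)!!) Δ_𝐱^{(q−1)/2} f = A + ωB` is monogenic on `Ω`, where
`A = ((1/r)∂_r)^{(q−1)/2}F₁`, `B = (∂_r(1/r))^{(q−1)/2}F₂` (values at `r = 0`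
taken as limits). -/
theorem fueter_sce_for_gsm
    (p q : ℕ) (hq : Odd q) {A : Type*} [NormedRing A] [NormedAlgebra ℝ A]
    (ξ : A ≃ₐ[ℝ] Cl (p + q))
    (Ω : Set (V p q)) (hΩ : IsSliceDomain p q Ω) (hsym : IsPSymmetric p q Ω)
    (f : V p q → A) (hf : GSMOn p q ξ Ω f)
    (F1 F2 : Sl p → A)
    (hF : ∀ z : Sl p, ∀ w ∈ S q, spt p q w z ∈ Ω →
      F1 z = (2 : ℝ)⁻¹ • (f (spt p q w z) + f (spt p q w (z.1, -z.2))) ∧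
      F2 z = (2 : ℝ)⁻¹ • (ωCl p q ξ w * (f (spt p q w (z.1, -z.2)) - f (spt p q w z)))) :
    ∃ AA BB : Sl p → A,
      (∀ z : Sl p, z.2 ≠ 0 → (∃ w ∈ S q, spt p q w z ∈ Ω) →
        AA z = AIter p F1 ((q - 1) / 2) z ∧ BB z = BIter p F2 ((q - 1) / 2) z) ∧
      (∀ x : Vp p, ((x, 0) : V p q) ∈ Ω →
        Tendsto (fun t : ℝ => AIter p F1 ((q - 1) / 2) (x, t)) (𝓝[≠] 0)
          (𝓝 (AA (x, 0))) ∧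
        Tendsto (fun t : ℝ => BIter p F2 ((q - 1) / 2) (x, t)) (𝓝[≠] 0)
          (𝓝 (BB (x, 0)))) ∧
      (∀ z : Sl p, ∀ v ∈ S q, spt p q v z ∈ Ω →
        tauq p q f (spt p q v z) = AA z + ωCl p q ξ v * BB z) ∧
      MonogenicOn p q ξ Ω (tauq p q f) := by
  have : FiniteDimensional ℝ A :=
    Module.Finite.equiv ξ.symm.toLinearEquiv
  have : CompleteSpace A := FiniteDimensional.complete ℝ A
  obtain ⟨N, hN⟩ := hq
  have hN' : (q - 1) / 2 = N := by omega
  obtain ⟨v, hv⟩ : ∃ v, v ∈ S q :=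
    ⟨EuclideanSpace.single ⟨0, by omega⟩ 1, mem_S_iff.2 (by simp)⟩
  set D := sliceSet p q Ω v
  have hΩo : IsOpen Ω := hΩ.1.1
  have hD : IsOpen D := (hΩ.2.2 v hv).1
  have hDr : ReflInv p D := hsym.reflInv_sliceSet hv
  have hmem {w : Vq q} (hw : w ∈ S q) {z : Sl p} (hz : spt p q w z ∈ Ω) : z ∈ D :=
    hsym.sliceSet_subset hw hv hz
  have hΩD : ∀ x ∈ Ω, ((x.1, ‖x.2‖) : Sl p) ∈ D := fun x hx => by
    obtain ⟨w, hw, hxw⟩ := exists_eq_spt hv x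
    exact hmem hw (hxw ▸ hx)
  have hneg : sliceSet p q Ω (-v) = D :=
    (hsym.sliceSet_subset (neg_mem_S hv) hv).antisymm (hsym.sliceSet_subset hv (neg_mem_S hv))
  obtain ⟨hg1, hg0⟩ := hf v hv
  obtain ⟨hh1, hh0⟩ := hf (-v) (neg_mem_S hv)
  rw [hneg] at hh1 hh0
  have hg := contDiffOn_of_slice_monogenic ξ hD hv hg1 hg0
  have hh := contDiffOn_of_slice_monogenic ξ hD (neg_mem_S hv) hh1 hh0
  simp only [spt_neg, ωCl_neg, neg_mul, ← sub_eq_add_neg] at hh hh0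
  have hF1 : Set.EqOn F1 (fun z => (2 : ℝ)⁻¹ • (f (spt p q v z) + f (spt p q v (z.1, -z.2)))) D :=
    fun z hz => (hF z v hv hz).1
  have hF2 : Set.EqOn F2 (fun z => (2 : ℝ)⁻¹ •
      (ωCl p q ξ v * (f (spt p q v (z.1, -z.2)) - f (spt p q v z)))) D :=
    fun z hz => (hF z v hv hz).2
  have hF1e : SmoothEvenOn D F1 := by
    refine ⟨((hg.add hh).const_smul (2 : ℝ)⁻¹).congr hF1, fun z hz => ?_⟩
    rw [hF1 hz, hF1 (hDr z hz)]
    simp [add_comm]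
  have hF2s : ContDiffOn ℝ (⊤ : ℕ∞) F2 D :=
    ((contDiffOn_const.mul (hh.sub hg)).const_smul (2 : ℝ)⁻¹).congr hF2
  have hF2o : ∀ z ∈ D, F2 (z.1, -z.2) = - F2 z := fun z hz => by
    rw [hF2 hz, hF2 (hDr z hz)]
    simp only [neg_neg, ← smul_neg, ← mul_neg, neg_sub]
  obtain ⟨G, hG, hF2G⟩ := SmoothEvenOn.exists_eq_smul hD hDr hF2s hF2o
  obtain ⟨Φ, hΦ, rfl⟩ := hF1e.exists_isRadSeqOn hD hDr
  obtain ⟨Γ, hΓ, rfl⟩ := hG.exists_isRadSeqOn hD hDr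
  have hCR' {z : Sl p} (hz : z ∈ D) := cauchyRiemann_of_slice_monogenic ξ hD hv
    (hg.differentiableOn (by simp)) (hh.differentiableOn (by simp)) hg0 hh0 hF1 hF2 hz
  have hF2d {z : Sl p} (hz : z ∈ D) : HasFDerivAt F2 (z.2 • fderiv ℝ (Γ 0) z +
      (ContinuousLinearMap.snd ℝ (Vp p) ℝ).smulRight (Γ 0 z)) z :=
    (hasFDerivAt_snd.smul (hG.differentiableAt hD hz).hasFDerivAt).congr_of_eventuallyEq
      (Set.EqOn.eventuallyEq_of_mem hF2G (hD.mem_nhds hz))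
  have hCR1 : ∀ z ∈ D, axialDirac (εp p q ξ) (Φ 0) z = Γ 0 z + z.2 ^ 2 • Γ 1 z := fun z hz => by
    have h : fderiv ℝ (Γ 0) z (0, 1) = z.2 • Γ 1 z := hΓ.radDeriv 0 z hz
    rw [(hCR' hz).1, pdr, (hF2d hz).fderiv]
    simp [h, smul_smul, sq, add_comm]
  have hCR2 : Set.EqOn (Φ 1) (fun z => - axialDirac (εpBar p q ξ) (Γ 0) z) D := by
    refine eqOn_of_smul_eqOn hD (hΦ.smoothEven 1).smooth.continuousOn
      (hG.axialDirac hD hDr _).neg.smooth.continuousOn fun z hz => ?_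
    rw [← hΦ.radDeriv 0 z hz, (hCR' hz).2, smul_neg]
    simp [axialDirac, pdSl, (hF2d hz).fderiv, Finset.smul_sum]
  have hCR : ∀ z ∈ D, axialDirac (εp p q ξ) (Φ 0) z = Γ 0 z + z.2 ^ 2 • Γ 1 z ∧
      Φ 1 z = - axialDirac (εpBar p q ξ) (Γ 0) z := fun z hz => ⟨hCR1 z hz, hCR2 hz⟩
  have hfΩ : Set.EqOn f (cliffordLift ξ (Φ 0) (Γ 0)) Ω := fun x hx => by
    obtain ⟨w, hw, hxw⟩ := exists_eq_spt hv x
    generalize ((x.1, ‖x.2‖) : Sl p) = z at hxw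
    subst hxw
    have hz := hmem hw hx
    rw [cliffordLift_spt ξ hF1e hG hw hz, ← hF2G z hz, (hF z w hw hx).1, (hF z w hw hx).2,
      mul_smul_comm, ← mul_assoc, ωCl_mul_self_of_mem_S ξ hw, neg_one_mul]
    module
  have hA := aIter_eqOn hD hΦ (Set.eqOn_refl _ _) N
  have hB := bIter_eqOn hD hΓ hF2G N
  rw [hN']
  refine ⟨Φ N, fun z => z.2 • Γ N z, fun z hz0 ⟨w, hw, hz⟩ => ?_, fun x hx => ?_,
    fun z w hw hz => ?_, monogenicOn_tauq ξ hD hDr hΩo hΩD hΦ hΓ hCR hN hfΩ⟩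
  · exact ⟨(hA ⟨hmem hw hz, hz0⟩).symm, (hB ⟨hmem hw hz, hz0⟩).symm⟩
  · have hxD : ((x, 0) : Sl p) ∈ D := by simpa using hΩD _ hx
    exact ⟨tendsto_of_eqOn_inter_ne_zero hD hA (hΦ.smoothEven N).smooth.continuousOn hxD,
      tendsto_of_eqOn_inter_ne_zero hD hB
        (continuousOn_snd.smul (hΓ.smoothEven N).smooth.continuousOn) hxD⟩
  · rw [tauq_eqOn_cliffordLift ξ hD hDr hΩo hΩD hΦ hΓ hCR hN hfΩ hz]
    exact cliffordLift_spt ξ (hΦ.smoothEven N) (hΓ.smoothEven N) hw (hmem hw hz)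
end
end

section
/- (Slice CK-extension) Let Ω₀ ⊆ ℝ^{p+1} be a domain and f₀ : Ω₀ → ℝ_{p+q} a real analytic function. Then the series CK[f₀](𝐱) = Σ_{k=0}^{∞} (1/k!) (𝐱_q D_{𝐱_p})^k f₀(𝐱_p), 𝐱 = 𝐱_p + 𝐱_q, converges normally on some p-symmetric slice domain Ω ⊆ Ω₀* containing Ω₀, the resulting function belongs to 𝒢𝒮ℳ(Ω), and its restriction to Ω₀ equals f₀; thus CK[f₀] is a slice Cauchy–Kovalevskaya extension of f₀. -/
/-!
Common framework for generalized partial-slice monogenic functions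
(Xu–Sabadini, "On the Fueter-Sce theorem for generalized partial-slice
monogenic functions").

The real Clifford algebra `ℝ_{p+q}` is formalized as the Mathlib Clifford
algebra of the negative-definite quadratic form on `ℝ^{p+q}`; since Mathlib
provides no canonical norm on it, all analytic statements are phrased for an
arbitrary normed real algebra `A` together with an `ℝ`-algebra isomorphism
`ξ : A ≃ₐ[ℝ] Cl (p+q)`.  A point of `ℝ^{p+q+1}` is a pair
`(𝐱_p, 𝐱_q) : (Fin (p+1) → ℝ) × EuclideanSpace ℝ (Fin q)`, and a point of a
slice `ℝ^{p+2}` is a pair `(𝐱_p, r)`.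
-/

noncomputable section

open Filter Topology MeasureTheory Metric
open scoped Nat RealInnerProductSpace

open GPS

namespace GPS

/-- Locally uniform Cauchy estimates for the iterated derivatives of an analytic function. -/
theorem exists_norm_iteratedFDeriv_le {E F : Type*} [NormedAddCommGroup E] [NormedSpace ℝ E]
    [NormedAddCommGroup F] [NormedSpace ℝ F] [CompleteSpace F] {f : E → F} {x : E}
    (hf : AnalyticAt ℝ f x) :
    ∃ ε > 0, ∃ C R : ℝ, 0 ≤ C ∧ 0 ≤ R ∧
      ∀ y ∈ ball x ε, ∀ k, ‖iteratedFDeriv ℝ k f y‖ ≤ C * R ^ k * (k ! : ℝ) := by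
  obtain ⟨P, ρ, h⟩ := hf
  obtain ⟨s, hs0, hsρ⟩ := ENNReal.lt_iff_exists_nnreal_btwn.1 h.r_pos
  have hs0' : 0 < s := by exact_mod_cast hs0
  obtain ⟨r, hr, rfl⟩ : ∃ r : NNReal, 0 < r ∧ r + r = s :=
    ⟨s / 2, half_pos hs0', add_halves s⟩
  have hrad : ((r : ENNReal) + r) < P.radius := lt_of_lt_of_le (by exact_mod_cast hsρ) h.r_le
  have hsum := P.changeOriginSeries_summable_aux₁ hrad
  set T := ∑' s : Σ k l : ℕ, { s : Finset (Fin (k + l)) // s.card = l },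
      ‖P (s.1 + s.2.1)‖₊ * r ^ s.2.1 * r ^ s.1 with hT
  refine ⟨r, hr, T, (r : ℝ)⁻¹, T.2, by positivity, fun y hy k => ?_⟩
  have hyr : ‖y - x‖₊ < r := by
    rw [mem_ball, dist_eq_norm] at hy
    exact_mod_cast hy
  have hrρ : (r : ENNReal) < ρ := lt_of_le_of_lt (by push_cast; exact le_self_add) hsρ
  have hyρ : (‖y - x‖₊ : ENNReal) < ρ := lt_trans (by exact_mod_cast hyr) hrρ
  have hc := h.changeOrigin hyρ
  rw [add_sub_cancel] at hc
  have hco : ‖P.changeOrigin (y - x) k‖₊ * r ^ k ≤ T := by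
    have h1 := P.nnnorm_changeOrigin_le k (x := y - x) (hyρ.trans_le h.r_le)
    have h2 := (NNReal.summable_sigma.1 hsum).1 k
    have hs2 := P.changeOriginSeries_summable_aux₂
      (lt_of_lt_of_le hrρ h.r_le) k
    have h3 : ∑' s : Σ l : ℕ, { s : Finset (Fin (k + l)) // s.card = l },
        ‖P (k + s.1)‖₊ * ‖y - x‖₊ ^ s.1 ≤
        ∑' s : Σ l : ℕ, { s : Finset (Fin (k + l)) // s.card = l },
          ‖P (k + s.1)‖₊ * r ^ s.1 := by
      refine Summable.tsum_le_tsum (fun s => by gcongr) ?_ hs2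
      exact NNReal.summable_of_le (fun s => by gcongr) hs2
    calc ‖P.changeOrigin (y - x) k‖₊ * r ^ k
        ≤ (∑' s : Σ l : ℕ, { s : Finset (Fin (k + l)) // s.card = l },
          ‖P (k + s.1)‖₊ * r ^ s.1) * r ^ k := by gcongr; exact h1.trans h3
      _ = ∑' s : Σ l : ℕ, { s : Finset (Fin (k + l)) // s.card = l },
          ‖P (k + s.1)‖₊ * r ^ s.1 * r ^ k := by rw [NNReal.tsum_mul_right]
      _ ≤ T := by
          rw [hT, hsum.tsum_sigma' (NNReal.summable_sigma.1 hsum).1]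
          exact (NNReal.summable_sigma.1 hsum).2.le_tsum k (fun _ _ => zero_le)
  have hco' : ‖P.changeOrigin (y - x) k‖ ≤ T * (r : ℝ)⁻¹ ^ k := by
    rw [inv_pow, ← div_eq_mul_inv, le_div_iff₀ (by positivity)]
    exact_mod_cast hco
  refine ContinuousMultilinearMap.opNorm_le_bound (by positivity) fun v => ?_
  rw [hc.iteratedFDeriv_eq_sum_of_completeSpace]
  calc ‖∑ σ : Equiv.Perm (Fin k), P.changeOrigin (y - x) k fun i => v (σ i)‖
      ≤ ∑ _σ : Equiv.Perm (Fin k), T * (r : ℝ)⁻¹ ^ k * ∏ i, ‖v i‖ := by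
        refine norm_sum_le_of_le _ fun σ _ => ?_
        refine (ContinuousMultilinearMap.le_opNorm _ _).trans ?_
        rw [Equiv.prod_comp σ fun i => ‖v i‖]
        gcongr
    _ = _ := by
        rw [Finset.sum_const, Finset.card_univ, Fintype.card_perm, Fintype.card_fin, nsmul_eq_mul]
        ring

/-- A set that is fibrewise star-shaped around a connected base is connected. -/
theorem isConnected_of_starShaped_fibers {X E : Type*} [TopologicalSpace X]
    [NormedAddCommGroup E] [NormedSpace ℝ E] {B : Set X} (hB : IsConnected B) {W : Set (X × E)}
    (hfst : ∀ z ∈ W, z.1 ∈ B) (hbase : ∀ x ∈ B, (x, (0 : E)) ∈ W)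
    (hstar : ∀ z ∈ W, ∀ t ∈ Set.Icc (0 : ℝ) 1, (z.1, t • z.2) ∈ W) : IsConnected W := by
  obtain ⟨x₀, hx₀⟩ := hB.nonempty
  refine ⟨⟨(x₀, 0), hbase x₀ hx₀⟩, isPreconnected_of_forall (x₀, 0) fun z hz => ?_⟩
  refine ⟨(fun x => (x, (0 : E))) '' B ∪ (fun t : ℝ => (z.1, t • z.2)) '' Set.Icc 0 1,
    ?_, Or.inl ⟨x₀, hx₀, rfl⟩, Or.inr ⟨1, by simp, by simp⟩, ?_⟩
  · rintro _ (⟨x, hx, rfl⟩ | ⟨t, ht, rfl⟩)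
    · exact hbase x hx
    · exact hstar z hz t ht
  · refine IsPreconnected.union (z.1, 0) ⟨z.1, hfst z hz, rfl⟩ ⟨0, by simp, by simp⟩ ?_ ?_
    · exact hB.isPreconnected.image _ (by fun_prop)
    · exact isPreconnected_Icc.image _ (by fun_prop)

/-- The points of `B × E` near which `f` satisfies Cauchy estimates of radius at least `K ‖z.2‖`. -/
def cauchyDomain {X F : Type*} (E : Type*) [NormedAddCommGroup X] [NormedSpace ℝ X]
    [NormedAddCommGroup F] [NormedSpace ℝ F] [NormedAddCommGroup E]
    (B : Set X) (f : X → F) (K : ℝ) : Set (X × E) :=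
  {z | ∃ U ⊆ B, IsOpen U ∧ z.1 ∈ U ∧ ∃ C R : ℝ, 0 ≤ C ∧ 0 ≤ R ∧ K * R * ‖z.2‖ < 1 ∧
    ∀ y ∈ U, ∀ k, ‖iteratedFDeriv ℝ k f y‖ ≤ C * R ^ k * (k ! : ℝ)}

section CauchyDomain

variable {X F E : Type*} [NormedAddCommGroup X] [NormedSpace ℝ X]
    [NormedAddCommGroup F] [NormedSpace ℝ F] [NormedAddCommGroup E]
    {B : Set X} {f : X → F} {K : ℝ}

theorem fst_mem_of_mem_cauchyDomain {z : X × E} (hz : z ∈ cauchyDomain E B f K) : z.1 ∈ B := by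
  obtain ⟨U, hUB, -, hzU, -⟩ := hz
  exact hUB hzU

theorem isOpen_cauchyDomain : IsOpen (cauchyDomain E B f K) := by
  rw [isOpen_iff_mem_nhds]
  rintro z ⟨U, hUB, hU, hzU, C, R, hC, hR, hlt, hb⟩
  have h1 : ∀ᶠ w : X × E in 𝓝 z, w.1 ∈ U := continuous_fst.continuousAt (hU.mem_nhds hzU)
  have h2 : ∀ᶠ w : X × E in 𝓝 z, K * R * ‖w.2‖ < 1 :=
    (by fun_prop : Continuous fun w : X × E => K * R * ‖w.2‖).continuousAt.eventually_lt
      continuousAt_const hlt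
  filter_upwards [h1, h2] with w hw1 hw2
  exact ⟨U, hUB, hU, hw1, C, R, hC, hR, hw2, hb⟩

theorem mem_cauchyDomain_of_norm_le {E' : Type*} [NormedAddCommGroup E'] (hK : 0 ≤ K) {x : X}
    {y : E} {y' : E'} (hy : ‖y'‖ ≤ ‖y‖) (h : (x, y) ∈ cauchyDomain E B f K) :
    (x, y') ∈ cauchyDomain E' B f K := by
  obtain ⟨U, hUB, hU, hzU, C, R, hC, hR, hlt, hb⟩ := h
  exact ⟨U, hUB, hU, hzU, C, R, hC, hR,
    (mul_le_mul_of_nonneg_left hy (by positivity)).trans_lt hlt, hb⟩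

theorem zero_mem_cauchyDomain [CompleteSpace F] (hB : IsOpen B) (hf : AnalyticOnNhd ℝ f B) {x : X}
    (hx : x ∈ B) : (x, (0 : E)) ∈ cauchyDomain E B f K := by
  obtain ⟨ε, hε, C, R, hC, hR, hb⟩ := exists_norm_iteratedFDeriv_le (hf x hx)
  exact ⟨B ∩ ball x ε, Set.inter_subset_left, hB.inter isOpen_ball, ⟨hx, mem_ball_self hε⟩,
    C, R, hC, hR, by simp, fun y hy => hb y hy.2⟩

theorem isDomain_cauchyDomain [NormedSpace ℝ E] [CompleteSpace F] (hK : 0 ≤ K)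
    (hB : GPS.IsDomain B) (hf : AnalyticOnNhd ℝ f B) : GPS.IsDomain (cauchyDomain E B f K) := by
  refine ⟨isOpen_cauchyDomain, isConnected_of_starShaped_fibers hB.2
    (fun z => fst_mem_of_mem_cauchyDomain) (fun x => zero_mem_cauchyDomain hB.1 hf)
    fun z hz t ht => mem_cauchyDomain_of_norm_le hK ?_ hz⟩
  rw [norm_smul, Real.norm_of_nonneg ht.1]
  exact mul_le_of_le_one_left (norm_nonneg _) ht.2

end CauchyDomain

theorem hasSum_clm_apply {X F : Type*} [NormedAddCommGroup X] [NormedSpace ℝ X]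
    [NormedAddCommGroup F] [NormedSpace ℝ F] {L : ℕ → X →L[ℝ] F} {L₀ : X →L[ℝ] F}
    (h : HasSum L L₀) (w : X) : HasSum (fun k => L k w) (L₀ w) :=
  h.mapL (ContinuousLinearMap.apply ℝ F w)

/-- Termwise differentiation of `∑ rᵏ / k! • G k x` under Cauchy estimates on `G`. -/
theorem hasFDerivAt_tsum_pow_smul {X F : Type*} [NormedAddCommGroup X] [NormedSpace ℝ X]
    [NormedAddCommGroup F] [NormedSpace ℝ F] [CompleteSpace F] {G : ℕ → X → F} {x₀ : X}
    {ε δ B C C' : ℝ} (hC : 0 ≤ C) (hC' : 0 ≤ C') (hB : 0 ≤ B) (hδ : B * δ < 1)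
    (hG : ∀ k, ContDiffOn ℝ 1 (G k) (ball x₀ ε))
    (hb : ∀ k, ∀ x ∈ ball x₀ ε, ‖G k x‖ ≤ C * B ^ k * (k ! : ℝ))
    (hb' : ∀ k, ∀ x ∈ ball x₀ ε, ‖fderiv ℝ (G k) x‖ ≤ C' * B ^ k * ((k + 1)! : ℝ))
    {F' : ℕ → X × ℝ → X × ℝ →L[ℝ] F}
    (hF' : ∀ k z, F' k z = (z.2 ^ k / (k ! : ℝ)) • (fderiv ℝ (G k) z.1).comp
        (ContinuousLinearMap.fst ℝ X ℝ) +
      (k * z.2 ^ (k - 1) / (k ! : ℝ)) •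
        (ContinuousLinearMap.snd ℝ X ℝ).smulRight (G k z.1)) :
    (∀ z ∈ ball x₀ ε ×ˢ ball (0 : ℝ) δ, Summable (F' · z) ∧
      HasFDerivAt (fun z : X × ℝ => ∑' k, (z.2 ^ k / (k ! : ℝ)) • G k z.1) (∑' k, F' k z) z) ∧
    ContinuousOn (fun z => ∑' k, F' k z) (ball x₀ ε ×ˢ ball (0 : ℝ) δ) := by
  rcases (ball (0 : ℝ) δ).eq_empty_or_nonempty with hne | hne
  · simp [hne]
  have hδ0 : 0 < δ := nonempty_ball.1 hne
  set θ := B * δ with hθ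
  have hθ0 : 0 ≤ θ := by positivity
  have hθ1 : ‖θ‖ < 1 := by rwa [Real.norm_of_nonneg hθ0]
  set s := ball x₀ ε ×ˢ ball (0 : ℝ) δ with hs
  have hso : IsOpen s := isOpen_ball.prod isOpen_ball
  have hsc : IsPreconnected s := ((convex_ball x₀ ε).prod (convex_ball 0 δ)).isPreconnected
  have hpow : ∀ k, ∀ z ∈ s, |z.2| ^ k * B ^ k ≤ θ ^ k := fun k z hz => by
    have hz2 : |z.2| < δ := by simpa using hz.2
    rw [← mul_pow, mul_comm, hθ]
    gcongr
  have hsum0 : Summable fun k : ℕ => θ ^ k := summable_geometric_of_norm_lt_one hθ1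
  have hsum1 : Summable fun k : ℕ => (k : ℝ) * θ ^ k := by
    simpa using summable_pow_mul_geometric_of_norm_lt_one 1 hθ1
  set M : ℕ → ℝ := fun k => C' * (((k : ℝ) + 1) * θ ^ k) + C * B * (k * θ ^ (k - 1)) with hM
  have hMsum : Summable M := by
    refine Summable.add (Summable.mul_left _ ?_) (Summable.mul_left _ ?_)
    · simpa only [add_mul, one_mul] using hsum1.add hsum0
    · rw [← summable_nat_add_iff 1]
      simpa [add_mul] using hsum1.add hsum0
  have hf : ∀ k, ∀ z ∈ s,
      HasFDerivAt (fun z : X × ℝ => (z.2 ^ k / (k ! : ℝ)) • G k z.1) (F' k z) z := by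
    intro k z hz
    have h1 : HasFDerivAt (fun z : X × ℝ => G k z.1)
        ((fderiv ℝ (G k) z.1).comp (ContinuousLinearMap.fst ℝ X ℝ)) z :=
      (((hG k).contDiffAt (isOpen_ball.mem_nhds hz.1)).differentiableAt
        one_ne_zero).hasFDerivAt.comp z hasFDerivAt_fst
    have h2 : HasFDerivAt (fun z : X × ℝ => z.2 ^ k / (k ! : ℝ))
        ((k * z.2 ^ (k - 1) / (k ! : ℝ)) • ContinuousLinearMap.snd ℝ X ℝ) z := by
      have := ((hasDerivAt_pow k z.2).div_const (k ! : ℝ)).comp_hasFDerivAt z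
        (hasFDerivAt_snd (𝕜 := ℝ) (p := z))
      exact this
    convert! h2.smul h1 using 1
    rw [hF']
    ext v <;> simp
  have hF'b : ∀ k, ∀ z ∈ s, ‖F' k z‖ ≤ M k := by
    intro k z hz
    have hk : (0 : ℝ) < (k ! : ℝ) := by positivity
    rw [hF', hM]
    refine (norm_add_le _ _).trans (add_le_add ?_ ?_)
    · rw [norm_smul, norm_div, norm_pow, Real.norm_eq_abs, Real.norm_of_nonneg hk.le]
      have hcomp : ‖(fderiv ℝ (G k) z.1).comp (ContinuousLinearMap.fst ℝ X ℝ)‖ ≤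
          C' * B ^ k * ((k + 1)! : ℝ) :=
        (ContinuousLinearMap.opNorm_comp_le _ _).trans
          ((mul_le_of_le_one_right (norm_nonneg _)
            (ContinuousLinearMap.norm_fst_le ℝ X ℝ)).trans (hb' k z.1 hz.1))
      calc |z.2| ^ k / (k ! : ℝ) * ‖(fderiv ℝ (G k) z.1).comp (ContinuousLinearMap.fst ℝ X ℝ)‖
          ≤ |z.2| ^ k / (k ! : ℝ) * (C' * B ^ k * ((k + 1)! : ℝ)) := by gcongr
        _ = C' * (((k : ℝ) + 1) * (|z.2| ^ k * B ^ k)) := by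
          rw [Nat.factorial_succ]
          push_cast
          field_simp
        _ ≤ _ := by gcongr; exact hpow k z hz
    · rcases k with _ | k
      · simp
      rw [norm_smul, norm_div, norm_mul, norm_pow, Real.norm_eq_abs z.2, Real.norm_of_nonneg hk.le,
        ContinuousLinearMap.norm_smulRight_apply, Real.norm_of_nonneg (Nat.cast_nonneg _),
        Nat.add_sub_cancel]
      calc ((k + 1 : ℕ) : ℝ) * |z.2| ^ k / ((k + 1)! : ℝ) *
            (‖ContinuousLinearMap.snd ℝ X ℝ‖ * ‖G (k + 1) z.1‖)
          ≤ ((k + 1 : ℕ) : ℝ) * |z.2| ^ k / ((k + 1)! : ℝ) *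
            (1 * (C * B ^ (k + 1) * ((k + 1)! : ℝ))) := by
            gcongr
            · exact ContinuousLinearMap.norm_snd_le ℝ X ℝ
            · exact hb _ _ hz.1
        _ = C * B * (((k + 1 : ℕ) : ℝ) * (|z.2| ^ k * B ^ k)) := by
          field_simp
          ring
        _ ≤ _ := by gcongr; exact hpow k z hz
  have hcont : ∀ k, ContinuousOn (F' k) s := by
    intro k
    have h1 : ContinuousOn (fun z : X × ℝ => G k z.1) s :=
      (hG k).continuousOn.comp continuousOn_fst fun z hz => hz.1
    have h2 : ContinuousOn (fun z : X × ℝ => fderiv ℝ (G k) z.1) s :=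
      ((hG k).continuousOn_fderiv_of_isOpen isOpen_ball le_rfl).comp continuousOn_fst
        fun z hz => hz.1
    have h3 : ContinuousOn (fun z : X × ℝ =>
        (ContinuousLinearMap.snd ℝ X ℝ).smulRight (G k z.1)) s := by
      have h := (ContinuousLinearMap.smulRightL ℝ (X × ℝ) F
        (ContinuousLinearMap.snd ℝ X ℝ)).continuous
      exact h.comp_continuousOn' h1
    have h4 : ContinuousOn (fun z : X × ℝ =>
        (fderiv ℝ (G k) z.1).comp (ContinuousLinearMap.fst ℝ X ℝ)) s :=
      h2.clm_comp continuousOn_const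
    have h5 : ContinuousOn (fun z : X × ℝ => z.2 ^ k / (k ! : ℝ)) s := by fun_prop
    have h6 : ContinuousOn (fun z : X × ℝ => k * z.2 ^ (k - 1) / (k ! : ℝ)) s := by fun_prop
    exact ((h5.smul h4).add (h6.smul h3)).congr fun z _ => hF' k z
  refine ⟨fun z hz => ⟨Summable.of_norm_bounded hMsum fun k => hF'b k z hz, ?_⟩,
    continuousOn_tsum hcont hMsum fun k z hz => hF'b k z hz⟩
  have hx₀ : (x₀, (0 : ℝ)) ∈ s :=
    ⟨mem_ball_self (dist_nonneg.trans_lt hz.1), mem_ball_self hδ0⟩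
  refine hasFDerivAt_tsum_of_isPreconnected hMsum hso hsc hf hF'b hx₀ ?_ hz
  refine summable_of_ne_finset_zero (s := {0}) fun k hk => ?_
  simp [Finset.notMem_singleton.1 hk]

section CliffordSeries

variable (p q : ℕ) {A : Type*} [NormedRing A] [NormedAlgebra ℝ A] (ξ : A ≃ₐ[ℝ] Cl (p + q))

/-- The principal symbol of `D_{𝐱_p}`, as a map on derivatives. -/
def diracSymbol : (Vp p →L[ℝ] A) →L[ℝ] A :=
  ∑ i, (ContinuousLinearMap.mul ℝ A (εp p q ξ i)).comp
    (ContinuousLinearMap.apply ℝ A (Pi.single i 1 : Vp p))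

theorem diracSymbol_apply (L : Vp p →L[ℝ] A) :
    diracSymbol p q ξ L = ∑ i, εp p q ξ i * L (Pi.single i 1) := by
  simp [diracSymbol]

theorem DPfun_eq_diracSymbol (g : Vp p → A) (x : Vp p) :
    DPfun p q ξ g x = diracSymbol p q ξ (fderiv ℝ g x) := by
  simp [diracSymbol_apply, DPfun, pdP]

theorem uDpow_succ_eq (u : A) (k : ℕ) (g : Vp p → A) :
    uDpow p q ξ u (k + 1) g =
      ((ContinuousLinearMap.mul ℝ A u).comp (diracSymbol p q ξ)) ∘
        fderiv ℝ (uDpow p q ξ u k g) := by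
  funext x
  simp [uDpow, DPfun_eq_diracSymbol]

theorem uDpow_smul (t : ℝ) (u : A) (k : ℕ) (g : Vp p → A) :
    uDpow p q ξ (t • u) k g = t ^ k • uDpow p q ξ u k g := by
  induction k with
  | zero => simp [uDpow]
  | succ k ih =>
    funext x
    simp only [uDpow_succ_eq, ih, Function.comp_apply, Pi.smul_apply, fderiv_const_smul_field]
    simp [smul_smul, pow_succ]

theorem analyticOnNhd_uDpow [CompleteSpace A] {u : A} {g : Vp p → A} {s : Set (Vp p)}
    (hg : AnalyticOnNhd ℝ g s) (k : ℕ) : AnalyticOnNhd ℝ (uDpow p q ξ u k g) s := by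
  induction k with
  | zero => exact hg
  | succ k ih =>
    rw [uDpow_succ_eq]
    exact ContinuousLinearMap.comp_analyticOnNhd _ ih.fderiv

theorem norm_iteratedFDeriv_uDpow_le [CompleteSpace A] (u : A) {g : Vp p → A} {s : Set (Vp p)}
    (hg : AnalyticOnNhd ℝ g s) (k n : ℕ) {x : Vp p} (hx : x ∈ s) :
    ‖iteratedFDeriv ℝ n (uDpow p q ξ u k g) x‖ ≤
      (‖u‖ * ‖diracSymbol p q ξ‖) ^ k * ‖iteratedFDeriv ℝ (n + k) g x‖ := by
  induction k generalizing n with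
  | zero => simp [uDpow]
  | succ k ih =>
    rw [uDpow_succ_eq]
    refine (ContinuousLinearMap.norm_iteratedFDeriv_comp_left _
      ((analyticOnNhd_uDpow p q ξ hg k).fderiv x hx).contDiffAt (N := (n : ℕ∞)) le_rfl).trans ?_
    rw [norm_iteratedFDeriv_fderiv, pow_succ', mul_assoc, add_comm k 1, ← add_assoc]
    refine mul_le_mul ?_ (ih (n + 1)) (norm_nonneg _) (by positivity)
    refine (ContinuousLinearMap.opNorm_comp_le _ _).trans ?_
    gcongr
    exact ContinuousLinearMap.opNorm_mul_apply_le ℝ A u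

theorem finiteDimensional_of_algEquiv_Cl {n : ℕ} (ξ : A ≃ₐ[ℝ] Cl n) : FiniteDimensional ℝ A := by
  have : FiniteDimensional ℝ (ExteriorAlgebra ℝ (Fin n → ℝ)) :=
    (Pi.basisFun ℝ (Fin n)).ExteriorAlgebra.finiteDimensional_of_finite
  exact Module.Finite.equiv
    ((CliffordAlgebra.equivExterior (Qe n)).symm.trans ξ.symm.toLinearEquiv)

theorem norm_ωCl_le (v : Vq q) : ‖ωCl p q ξ v‖ ≤ (∑ j, ‖eQ p q ξ j‖) * ‖v‖ := by
  rw [Finset.sum_mul]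
  refine norm_sum_le_of_le _ fun j _ => ?_
  rw [norm_smul, mul_comm]
  gcongr
  exact PiLp.norm_apply_le v j

theorem ωCl_smul (t : ℝ) (v : Vq q) : ωCl p q ξ (t • v) = t • ωCl p q ξ v := by
  simp [ωCl, Finset.smul_sum, mul_smul]

theorem norm_eq_one_of_mem_S {v : Vq q} (hv : v ∈ S q) : ‖v‖ = 1 := by
  have hv' : ∑ j, v j ^ 2 = 1 := hv
  simp [EuclideanSpace.norm_eq, hv']

theorem ωCl_eq_symm_ι (v : Vq q) :
    ωCl p q ξ v = ξ.symm (CliffordAlgebra.ι (Qe (p + q)) (Fin.append (0 : Fin p → ℝ) v)) := by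
  rw [pi_eq_sum_univ' (Fin.append (0 : Fin p → ℝ) v)]
  have h : ∀ j : Fin q, (⟨p + j, by omega⟩ : Fin (p + q)) = Fin.natAdd p j := fun _ => rfl
  simp [ωCl, Fin.sum_univ_add, eQ, gen, e, h]

theorem ωCl_mul_self {v : Vq q} (hv : v ∈ S q) : ωCl p q ξ v * ωCl p q ξ v = -1 := by
  have hv' : ∑ j, v j * v j = 1 := by
    simp only [← sq]
    exact hv
  rw [ωCl_eq_symm_ι, ← map_mul, CliffordAlgebra.ι_sq_scalar, AlgEquiv.commutes]
  simp [Qe, QuadraticMap.weightedSumSquares_apply, Fin.sum_univ_add, hv']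

/-- A bound for the principal symbol of `ω D_{𝐱_p}`, uniform in `ω ∈ 𝕊`. -/
def ckConst : ℝ := (∑ j, ‖eQ p q ξ j‖) * ‖diracSymbol p q ξ‖

theorem ckConst_nonneg : 0 ≤ ckConst p q ξ :=
  mul_nonneg (Finset.sum_nonneg fun _ _ => norm_nonneg _) (norm_nonneg (diracSymbol p q ξ))

theorem norm_ωCl_mul_norm_diracSymbol_le (v : Vq q) :
    ‖ωCl p q ξ v‖ * ‖diracSymbol p q ξ‖ ≤ ckConst p q ξ * ‖v‖ := by
  rw [ckConst, mul_right_comm]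
  gcongr
  exact norm_ωCl_le p q ξ v

theorem norm_iteratedFDeriv_uDpow_ωCl_le [CompleteSpace A] {f : Vp p → A} {s U : Set (Vp p)}
    (hf : AnalyticOnNhd ℝ f s) (hU : U ⊆ s) {C R : ℝ}
    (hb : ∀ y ∈ U, ∀ k, ‖iteratedFDeriv ℝ k f y‖ ≤ C * R ^ k * (k ! : ℝ))
    (v : Vq q) (k n : ℕ) {x : Vp p} (hx : x ∈ U) :
    ‖iteratedFDeriv ℝ n (uDpow p q ξ (ωCl p q ξ v) k f) x‖ ≤
      C * R ^ n * (ckConst p q ξ * R * ‖v‖) ^ k * ((n + k)! : ℝ) := by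
  have hK := ckConst_nonneg p q ξ
  calc _ ≤ (‖ωCl p q ξ v‖ * ‖diracSymbol p q ξ‖) ^ k * ‖iteratedFDeriv ℝ (n + k) f x‖ :=
        norm_iteratedFDeriv_uDpow_le p q ξ _ hf k n (hU hx)
    _ ≤ (ckConst p q ξ * ‖v‖) ^ k * (C * R ^ (n + k) * ((n + k)! : ℝ)) := by
        refine mul_le_mul (pow_le_pow_left₀ (by positivity) ?_ k) (hb x hx _) (norm_nonneg _)
          (by positivity)
        exact norm_ωCl_mul_norm_diracSymbol_le p q ξ v
    _ = _ := by ring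

theorem exists_summable_norm_ckTerm_le [CompleteSpace A] {f : Vp p → A} {s : Set (Vp p)}
    (hf : AnalyticOnNhd ℝ f s) {K : Set (V p q)}
    (hKs : K ⊆ cauchyDomain (Vq q) s f (ckConst p q ξ)) (hK : IsCompact K) :
    ∃ M : ℕ → ℝ, Summable M ∧ ∀ k, ∀ z ∈ K, ‖ckTerm p q ξ f k z‖ ≤ M k := by
  refine hK.induction_on
    (p := fun K => ∃ M : ℕ → ℝ, Summable M ∧ ∀ k, ∀ z ∈ K, ‖ckTerm p q ξ f k z‖ ≤ M k)
    ⟨0, summable_zero, by simp⟩ ?_ ?_ ?_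
  · rintro K₁ K₂ h ⟨M, hM, hb⟩
    exact ⟨M, hM, fun k z hz => hb k z (h hz)⟩
  · rintro K₁ K₂ ⟨M₁, hM₁, hb₁⟩ ⟨M₂, hM₂, hb₂⟩
    refine ⟨fun k => |M₁ k| + |M₂ k|, hM₁.abs.add hM₂.abs, fun k z hz => ?_⟩
    rcases hz with hz | hz
    · exact ((hb₁ k z hz).trans (le_abs_self _)).trans (le_add_of_nonneg_right (abs_nonneg _))
    · exact ((hb₂ k z hz).trans (le_abs_self _)).trans (le_add_of_nonneg_left (abs_nonneg _))
  · intro z hz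
    obtain ⟨U, hUs, hU, hzU, C, R, hC, hR, hlt, hb⟩ := hKs hz
    obtain ⟨θ, hzθ, hθ1⟩ := exists_between hlt
    have hc := ckConst_nonneg p q ξ
    have hθ0 : 0 ≤ θ := le_trans (by positivity) hzθ.le
    have h1 : ∀ᶠ w : V p q in 𝓝 z, w.1 ∈ U := continuous_fst.continuousAt (hU.mem_nhds hzU)
    have h2 : ∀ᶠ w : V p q in 𝓝 z, ckConst p q ξ * R * ‖w.2‖ < θ :=
      (by fun_prop : Continuous fun w : V p q =>
        ckConst p q ξ * R * ‖w.2‖).continuousAt.eventually_lt continuousAt_const hzθ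
    refine ⟨_, mem_nhdsWithin_of_mem_nhds (h1.and h2), fun k => C * θ ^ k,
      (summable_geometric_of_lt_one hθ0 hθ1).mul_left C, fun k w hw => ?_⟩
    have h := norm_iteratedFDeriv_uDpow_ωCl_le p q ξ hf hUs hb w.2 k 0 hw.1
    rw [norm_iteratedFDeriv_zero, pow_zero, mul_one, zero_add] at h
    rw [ckTerm, norm_smul, norm_inv, Real.norm_natCast, inv_mul_le_iff₀ (by positivity),
      mul_comm (k ! : ℝ)]
    refine h.trans ?_
    have h3 := hw.2.le
    simp only
    gcongr

theorem hasSum_ckTerm [CompleteSpace A] {f : Vp p → A} {s : Set (Vp p)}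
    (hf : AnalyticOnNhd ℝ f s) {z : V p q}
    (hz : z ∈ cauchyDomain (Vq q) s f (ckConst p q ξ)) :
    HasSum (fun k => ckTerm p q ξ f k z) (CKext p q ξ f z) := by
  obtain ⟨M, hM, hb⟩ := exists_summable_norm_ckTerm_le p q ξ hf
    (Set.singleton_subset_iff.2 hz) isCompact_singleton
  exact (Summable.of_norm_bounded hM fun k => hb k z rfl).hasSum

theorem ckTerm_zero_right (f : Vp p → A) (x : Vp p) (k : ℕ) :
    ckTerm p q ξ f k (x, 0) = if k = 0 then f x else 0 := by
  rcases k with _ | k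
  · simp [ckTerm, uDpow]
  · simp [ckTerm, uDpow, ωCl]

theorem CKext_zero_right (f : Vp p → A) (x : Vp p) : CKext p q ξ f (x, 0) = f x := by
  simp [CKext, ckTerm_zero_right]

theorem CKext_spt (f : Vp p → A) (v : Vq q) (z : Sl p) :
    CKext p q ξ f (spt p q v z) =
      ∑' k, (z.2 ^ k / (k ! : ℝ)) • uDpow p q ξ (ωCl p q ξ v) k f z.1 := by
  simp [CKext, ckTerm, spt, ωCl_smul, uDpow_smul, smul_smul, div_eq_inv_mul]

theorem sliceSet_cauchyDomain {f : Vp p → A} {s : Set (Vp p)} {K : ℝ} (hK : 0 ≤ K) {v : Vq q}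
    (hv : v ∈ S q) : sliceSet p q (cauchyDomain (Vq q) s f K) v = cauchyDomain ℝ s f K := by
  have h : ∀ r : ℝ, ‖r • v‖ = ‖r‖ := fun r => by rw [norm_smul, norm_eq_one_of_mem_S q hv, mul_one]
  exact Set.ext fun z => ⟨mem_cauchyDomain_of_norm_le hK (h z.2).ge,
    mem_cauchyDomain_of_norm_le hK (h z.2).le⟩

theorem GSMOn_CKext [CompleteSpace A] {f : Vp p → A} {s : Set (Vp p)}
    (hf : AnalyticOnNhd ℝ f s) :
    GSMOn p q ξ (cauchyDomain (Vq q) s f (ckConst p q ξ)) (CKext p q ξ f) := by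
  intro v hv
  have hK := ckConst_nonneg p q ξ
  rw [sliceSet_cauchyDomain p q hK hv, funext (CKext_spt p q ξ f v)]
  set G : ℕ → Vp p → A := fun k => uDpow p q ξ (ωCl p q ξ v) k f with hG
  set F' : ℕ → Sl p → Sl p →L[ℝ] A := fun k z =>
    (z.2 ^ k / (k ! : ℝ)) • (fderiv ℝ (G k) z.1).comp (ContinuousLinearMap.fst ℝ (Vp p) ℝ) +
      (k * z.2 ^ (k - 1) / (k ! : ℝ)) •
        (ContinuousLinearMap.snd ℝ (Vp p) ℝ).smulRight (G k z.1) with hF'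
  have key : ∀ z ∈ cauchyDomain ℝ s f (ckConst p q ξ), ∃ N, IsOpen N ∧ z ∈ N ∧
      (∀ w ∈ N, Summable (F' · w) ∧
        HasFDerivAt (fun w : Sl p => ∑' k, (w.2 ^ k / (k ! : ℝ)) • G k w.1) (∑' k, F' k w) w) ∧
      ContinuousOn (fun w => ∑' k, F' k w) N := by
    rintro z ⟨U, hUs, hU, hzU, C, R, hC, hR, hlt, hb⟩
    obtain ⟨ε, hε, hεU⟩ := Metric.isOpen_iff.1 hU z.1 hzU
    obtain ⟨δ, hδ, hzδ⟩ : ∃ δ, ckConst p q ξ * R * δ < 1 ∧ ‖z.2‖ < δ :=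
      (((by fun_prop : Continuous fun δ : ℝ => ckConst p q ξ * R * δ).continuousAt.eventually_lt
        continuousAt_const hlt).filter_mono nhdsWithin_le_nhds |>.and
          (self_mem_nhdsWithin (s := Set.Ioi ‖z.2‖))).exists
    have hGb := fun k n x (hx : x ∈ ball z.1 ε) =>
      norm_iteratedFDeriv_uDpow_ωCl_le p q ξ hf hUs hb v k n (hεU hx)
    simp only [norm_eq_one_of_mem_S q hv, mul_one] at hGb
    refine ⟨ball z.1 ε ×ˢ ball 0 δ, isOpen_ball.prod isOpen_ball,
      ⟨mem_ball_self hε, by simpa using hzδ⟩,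
      hasFDerivAt_tsum_pow_smul (C := C) (C' := C * R) hC (by positivity) (by positivity) hδ
        (fun k => ?_) (fun k x hx => ?_) (fun k x hx => ?_) fun k w => rfl⟩
    · exact ((analyticOnNhd_uDpow p q ξ hf k).mono (hεU.trans hUs)).contDiffOn
        isOpen_ball.uniqueDiffOn
    · simpa using hGb k 0 x hx
    · simpa [add_comm 1 k, norm_iteratedFDeriv_one] using hGb k 1 x hx
  constructor
  · intro z hz
    obtain ⟨N, hN, hzN, hd, hc⟩ := key z hz
    have h1 : ContDiffOn ℝ (0 + 1)
        (fun w : Sl p => ∑' k, (w.2 ^ k / (k ! : ℝ)) • G k w.1) N := by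
      rw [contDiffOn_succ_iff_fderiv_of_isOpen hN]
      refine ⟨fun w hw => (hd w hw).2.differentiableAt.differentiableWithinAt, by simp, ?_⟩
      rw [contDiffOn_zero]
      exact hc.congr fun w hw => (hd w hw).2.fderiv
    rw [zero_add] at h1
    exact (h1.contDiffAt (hN.mem_nhds hzN)).contDiffWithinAt
  · intro z hz
    obtain ⟨N, hN, hzN, hd, -⟩ := key z hz
    obtain ⟨hs, hd⟩ := hd z hzN
    have hsum : ∀ w, HasSum (fun k => F' k z w) ((∑' k, F' k z) w) := fun w =>
      hasSum_clm_apply hs.hasSum w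
    have hDP : HasSum (fun k => (z.2 ^ k / (k ! : ℝ)) • DPfun p q ξ (G k) z.1)
        (∑ i, εp p q ξ i * (∑' k, F' k z) (Pi.single i 1, 0)) := by
      have h := hasSum_sum (s := Finset.univ)
        fun i _ => (hsum (Pi.single i 1, 0)).mul_left (εp p q ξ i)
      have hterm : ∀ k, ∑ i, εp p q ξ i * F' k z (Pi.single i 1, 0) =
          (z.2 ^ k / (k ! : ℝ)) • DPfun p q ξ (G k) z.1 := fun k => by
        simp [hF', DPfun, pdP, Finset.smul_sum]
      simpa only [hterm] using h
    have hr : HasSum (fun k => -((z.2 ^ k / (k ! : ℝ)) • DPfun p q ξ (G k) z.1))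
        (ωCl p q ξ v * (∑' k, F' k z) (0, 1)) := by
      have h := (hsum (0, 1)).mul_left (ωCl p q ξ v)
      rw [← hasSum_nat_add_iff' 1] at h
      have hzero : F' 0 z (0, 1) = 0 := by simp [hF']
      have hterm : ∀ k, ωCl p q ξ v * F' (k + 1) z (0, 1) =
          -((z.2 ^ k / (k ! : ℝ)) • DPfun p q ξ (G k) z.1) := fun k => by
        have hGs : G (k + 1) z.1 = ωCl p q ξ v * DPfun p q ξ (G k) z.1 := rfl
        have hk : (((k + 1 : ℕ) : ℝ) * z.2 ^ k / ((k + 1)! : ℝ)) = z.2 ^ k / (k ! : ℝ) := by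
          rw [Nat.factorial_succ]
          push_cast
          field_simp
        have hF : F' (k + 1) z (0, 1) = (z.2 ^ k / (k ! : ℝ)) • G (k + 1) z.1 := by
          rw [← hk]
          simp [hF']
        rw [hF, hGs, mul_smul_comm, ← mul_assoc, ωCl_mul_self p q ξ hv, neg_one_mul, smul_neg]
      simpa only [hterm, Finset.sum_range_one, hzero, mul_zero, sub_zero] using h
    have h0 := (hDP.add hr).unique (by simpa only [add_neg_cancel] using hasSum_zero)
    rw [← hd.fderiv] at h0
    exact h0

end CliffordSeries

end GPS


/-- **Slice CK-extension** (Theorem 4.2).  For a real analytic `f₀ : Ω₀ → ℝ_{p+q}` on a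
domain `Ω₀ ⊆ ℝ^{p+1}`, the series `CK[f₀](𝐱) = ∑_k (1/k!)(𝐱_q D_{𝐱_p})^k f₀(𝐱_p)`
converges normally on some p-symmetric slice domain `Ω ⊆ Ω₀*` containing `Ω₀`, is
left generalized partial-slice monogenic there, and restricts to `f₀` on `Ω₀`. -/
theorem slice_CK_extension
    (p q : ℕ) (hq : 1 ≤ q) {A : Type*} [NormedRing A] [NormedAlgebra ℝ A]
    (ξ : A ≃ₐ[ℝ] Cl (p + q))
    (Ω₀ : Set (Vp p)) (hΩ₀ : IsDomain Ω₀)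
    (f₀ : Vp p → A) (hf₀ : AnalyticOnNhd ℝ f₀ Ω₀) :
    ∃ Ω : Set (V p q), IsPSymmetric p q Ω ∧ IsSliceDomain p q Ω ∧
      Ω ⊆ star0 p q Ω₀ ∧ (∀ x ∈ Ω₀, ((x, 0) : V p q) ∈ Ω) ∧
      (∀ K ⊆ Ω, IsCompact K → ∃ M : ℕ → ℝ, Summable M ∧
        ∀ k : ℕ, ∀ z ∈ K, ‖ckTerm p q ξ f₀ k z‖ ≤ M k) ∧
      (∀ z ∈ Ω, HasSum (fun k => ckTerm p q ξ f₀ k z) (CKext p q ξ f₀ z)) ∧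
      GSMOn p q ξ Ω (CKext p q ξ f₀) ∧
      ∀ x ∈ Ω₀, CKext p q ξ f₀ (x, 0) = f₀ x := by
  have : FiniteDimensional ℝ A := finiteDimensional_of_algEquiv_Cl ξ
  have : CompleteSpace A := FiniteDimensional.complete ℝ A
  have hK := ckConst_nonneg p q ξ
  have hzero := fun x hx => zero_mem_cauchyDomain (E := Vq q) (K := ckConst p q ξ) (x := x)
    hΩ₀.1 hf₀ hx
  refine ⟨cauchyDomain (Vq q) Ω₀ f₀ (ckConst p q ξ), ?_,
    ⟨isDomain_cauchyDomain hK hΩ₀ hf₀, ?_, ?_⟩, fun z => fst_mem_of_mem_cauchyDomain, hzero,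
    fun K hKΩ => exists_summable_norm_ckTerm_le p q ξ hf₀ hKΩ,
    fun z => hasSum_ckTerm p q ξ hf₀, GSMOn_CKext p q ξ hf₀,
    fun x _ => CKext_zero_right p q ξ f₀ x⟩
  · intro x r v hv w hw
    refine mem_cauchyDomain_of_norm_le hK ?_
    rw [norm_smul, norm_smul, norm_eq_one_of_mem_S q hv, norm_eq_one_of_mem_S q hw]
  · obtain ⟨x, hx⟩ := hΩ₀.2.nonempty
    exact ⟨x, hzero x hx⟩
  · intro v hv
    rw [sliceSet_cauchyDomain p q hK hv]
    exact isDomain_cauchyDomain hK hΩ₀ hf₀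
end
end
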